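/- Let f ∈ ℝ[x,y,z] be homogeneous of degree 4 defining a smooth complex plane quartic Q = V(f). If there exists a real line L∞ = V(ℓ∞) containing no real point of Q (i.e. there is no nonzero p ∈ ℝ³ with ℓ∞(p) = 0 and f(p) = 0; equivalently, the real points of Q form a compact curve in the affine plane ℙ²(ℝ) ∖ L∞), then Q has at least 4 distinct real bitangent lines. -/

import Mathlib

open MvPolynomial

noncomputable section

/-- Complexification of a real ternary polynomial. -/
def cmap (f : MvPolynomial (Fin 3) ℝ) : MvPolynomial (Fin 3) ℂ :=
  MvPolynomial.map (algebraMap ℝ ℂ) f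

/-- Evaluation of the complexification of `f` at a complex point. -/
def cev (f : MvPolynomial (Fin 3) ℝ) (p : Fin 3 → ℂ) : ℂ :=
  eval p (cmap f)

/-- The linear form with coefficient vector `ℓ`, evaluated at `p`. -/
def lin {R : Type*} [CommSemiring R] (ℓ p : Fin 3 → R) : R := ∑ i, ℓ i * p i

/-- The complexification of a real vector. -/
def cvec (v : Fin 3 → ℝ) : Fin 3 → ℂ := fun i => (v i : ℂ)

/-- Smoothness of the complex plane curve V(f): the gradient is nonzero at every
nonzero complex zero of `f`. -/
def SmoothQuartic (f : MvPolynomial (Fin 3) ℝ) : Prop :=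
  ∀ p : Fin 3 → ℂ, p ≠ 0 → cev f p = 0 → ∃ i, eval p (pderiv i (cmap f)) ≠ 0

/-- The line `V(ℓ)` is a bitangent of `V(f)` with tangency points `z₁, z₂`:
the restriction of `f` to the line is a nonzero scalar multiple of the square of a
nonzero quadratic form on the line, whose zeros (with multiplicity) are `z₁, z₂`.
Over ℂ the quadratic form is written as the product of two linear forms `m₁, m₂`,
each nonzero on the line and vanishing at the corresponding tangency point. -/
def IsBitangentAt (f : MvPolynomial (Fin 3) ℝ) (ℓ z₁ z₂ : Fin 3 → ℂ) : Prop :=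
  ℓ ≠ 0 ∧ z₁ ≠ 0 ∧ z₂ ≠ 0 ∧ lin ℓ z₁ = 0 ∧ lin ℓ z₂ = 0 ∧
  ∃ (m₁ m₂ : Fin 3 → ℂ) (c : ℂ), c ≠ 0 ∧
    lin m₁ z₁ = 0 ∧ lin m₂ z₂ = 0 ∧
    (∃ p, lin ℓ p = 0 ∧ lin m₁ p ≠ 0) ∧
    (∃ p, lin ℓ p = 0 ∧ lin m₂ p ≠ 0) ∧
    (∀ p, lin ℓ p = 0 → cev f p = c * (lin m₁ p * lin m₂ p) ^ 2)

/-- The line `V(ℓ)` is a bitangent of the quartic `V(f)`. -/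
def IsBitangent (f : MvPolynomial (Fin 3) ℝ) (ℓ : Fin 3 → ℂ) : Prop :=
  ∃ z₁ z₂, IsBitangentAt f ℓ z₁ z₂

/-- The set of real bitangent lines of `V(f)`, as points of the real projective
plane of lines. -/
def realBitangents (f : MvPolynomial (Fin 3) ℝ) :
    Set (Projectivization ℝ (Fin 3 → ℝ)) :=
  {L | IsBitangent f (cvec L.rep)}

/-- Directional derivative of (the complexification of) `f` along the real vector `v`. -/
def Dv (f : MvPolynomial (Fin 3) ℝ) (v : Fin 3 → ℝ) (z : Fin 3 → ℂ) : ℂ :=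
  ∑ i, (v i : ℂ) * eval z (pderiv i (cmap f))

/-- `Qtype_{L∞}(L) = ε ∈ {+1, -1}` for the real bitangent `L = V(ℓ)` of `V(f)`,
relative to the real line at infinity `V(ℓinf)`: for tangency points normalized so
that `ℓ∞(z̃ᵢ) = 1` and any real `v` with `ℓ(v) ≠ 0`, the product
`(D_v f)(z̃₁)·(D_v f)(z̃₂)` is a nonzero real number of sign `ε`. -/
def HasQtype (f : MvPolynomial (Fin 3) ℝ) (ℓinf : Fin 3 → ℝ) (ℓ : Fin 3 → ℂ)
    (ε : ℤ) : Prop :=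
  ∃ (z₁ z₂ : Fin 3 → ℂ) (v : Fin 3 → ℝ) (r : ℝ),
    IsBitangentAt f ℓ z₁ z₂ ∧
    lin (cvec ℓinf) z₁ = 1 ∧ lin (cvec ℓinf) z₂ = 1 ∧
    lin ℓ (cvec v) ≠ 0 ∧
    Dv f v z₁ * Dv f v z₂ = (r : ℂ) ∧
    ((0 < r ∧ ε = 1) ∨ (r < 0 ∧ ε = -1))

/-- A point of ℙ²(ℂ) (given by a nonzero vector) is real. -/
def IsRealPoint (z : Fin 3 → ℂ) : Prop :=
  ∃ (w : Fin 3 → ℝ) (t : ℂ), w ≠ 0 ∧ t ≠ 0 ∧ z = t • cvec w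

/-- `h : ℝ → ℂ` has a continuous logarithm whose increment over every period of length `2π`
is `2πik`; for a nowhere vanishing loop, `k` is its winding number about `0`. -/
def HasWinding (h : ℝ → ℂ) (k : ℤ) : Prop :=
  ∃ φ : ℝ → ℂ, Continuous φ ∧ (∀ θ, h θ = Complex.exp (φ θ)) ∧
    ∀ θ, φ (θ + 2 * Real.pi) = φ θ + k * (2 * Real.pi * Complex.I)

namespace HasWinding

variable {h h' : ℝ → ℂ} {k k' : ℤ}

lemma ne_zero (H : HasWinding h k) (θ : ℝ) : h θ ≠ 0 := by
  obtain ⟨φ, -, h2, -⟩ := H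
  rw [h2]; exact Complex.exp_ne_zero _

lemma continuous (H : HasWinding h k) : Continuous h := by
  obtain ⟨φ, h1, h2, -⟩ := H
  rw [funext h2]; fun_prop

lemma periodic (H : HasWinding h k) (θ : ℝ) : h (θ + 2 * Real.pi) = h θ := by
  obtain ⟨φ, -, h2, h3⟩ := H
  rw [h2, h2, h3, Complex.exp_add, Complex.exp_int_mul_two_pi_mul_I, mul_one]

lemma mul (H : HasWinding h k) (H' : HasWinding h' k') :
    HasWinding (fun θ => h θ * h' θ) (k + k') := by
  obtain ⟨φ, h1, h2, h3⟩ := H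
  obtain ⟨ψ, h1', h2', h3'⟩ := H'
  refine ⟨fun θ => φ θ + ψ θ, by fun_prop, fun θ => ?_, fun θ => ?_⟩
  · simp only [h2, h2', Complex.exp_add]
  · simp only [h3, h3']; push_cast; ring

lemma inv (H : HasWinding h k) : HasWinding (fun θ => (h θ)⁻¹) (-k) := by
  obtain ⟨φ, h1, h2, h3⟩ := H
  refine ⟨fun θ => -φ θ, by fun_prop, fun θ => ?_, fun θ => ?_⟩
  · simp only [h2, Complex.exp_neg]
  · simp only [h3]; push_cast; ring

lemma conj (H : HasWinding h k) : HasWinding (fun θ => (starRingEnd ℂ) (h θ)) (-k) := by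
  obtain ⟨φ, h1, h2, h3⟩ := H
  refine ⟨fun θ => (starRingEnd ℂ) (φ θ), Complex.continuous_conj.comp h1, fun θ => ?_,
    fun θ => ?_⟩
  · simp only [h2, Complex.exp_conj]
  · beta_reduce
    rw [h3, map_add, map_mul, map_mul, map_mul, Complex.conj_I, Complex.conj_ofReal, map_intCast,
      map_ofNat]
    push_cast; ring

lemma const {c : ℂ} (hc : c ≠ 0) : HasWinding (fun _ => c) 0 :=
  ⟨fun _ => Complex.log c, by fun_prop, fun _ => (Complex.exp_log hc).symm, by simp⟩

lemma exp_mul_I : HasWinding (fun θ => Complex.exp (θ * Complex.I)) 1 :=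
  ⟨fun θ => θ * Complex.I, by fun_prop, fun _ => rfl, fun θ => by push_cast; ring⟩

/-- Two loops which are never separated by more than a right angle have the same winding. -/
lemma of_re_pos (H : HasWinding h k) (hc : Continuous h')
    (hp : ∀ θ, h' (θ + 2 * Real.pi) = h' θ)
    (hre : ∀ θ, 0 < (h' θ * (starRingEnd ℂ) (h θ)).re) : HasWinding h' k := by
  have key : ∀ θ, h' θ / h θ ∈ Complex.slitPlane := fun θ => by
    left
    have h0 := H.ne_zero θ
    have : h' θ / h θ = h' θ * (starRingEnd ℂ) (h θ) * ((Complex.normSq (h θ))⁻¹ : ℝ) := by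
      rw [div_eq_mul_inv, Complex.inv_def]; ring
    rw [this, Complex.re_mul_ofReal]
    exact mul_pos (hre θ) (inv_pos.2 (Complex.normSq_pos.2 h0))
  have hdiv : HasWinding (fun θ => h' θ / h θ) 0 :=
    ⟨fun θ => Complex.log (h' θ / h θ),
      (hc.div₀ H.continuous H.ne_zero).clog key,
      fun θ => (Complex.exp_log (Complex.slitPlane_ne_zero (key θ))).symm,
      fun θ => by simp [hp, H.periodic]⟩
  have := H.mul hdiv
  simp only [add_zero] at this
  convert this using 2 with θ
  rw [mul_div_cancel₀ _ (H.ne_zero θ)]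

lemma unique (H : HasWinding h k) (H' : HasWinding h k') : k = k' := by
  obtain ⟨φ, h1, h2, h3⟩ := H
  obtain ⟨ψ, h1', h2', h3'⟩ := H'
  have hn : ∀ θ, ∃ n : ℤ, φ θ - ψ θ = n * (2 * Real.pi * Complex.I) := fun θ => by
    obtain ⟨n, hn⟩ := Complex.exp_eq_exp_iff_exists_int.1 ((h2 θ).symm.trans (h2' θ))
    exact ⟨n, by rw [hn]; ring⟩
  choose n hn using hn
  have hpi : (2 * Real.pi * Complex.I : ℂ) ≠ 0 := by simp [Real.pi_ne_zero]
  have hnc : Continuous n := by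
    have : Continuous fun θ => ((n θ : ℤ) : ℂ) := by
      have e : (fun θ => ((n θ : ℤ) : ℂ)) =
          fun θ => (φ θ - ψ θ) / (2 * Real.pi * Complex.I) := by
        funext θ; rw [hn, mul_div_cancel_right₀ _ hpi]
      rw [e]; fun_prop
    exact Int.isClosedEmbedding_coe_real.isEmbedding.continuous_iff.2
      (by simpa [Function.comp_def] using Complex.continuous_re.comp this)
  have hconst : n 0 = n (0 + 2 * Real.pi) := PreconnectedSpace.constant inferInstance hnc
  have e1 := hn (0 + 2 * Real.pi)
  rw [h3, h3', ← hconst] at e1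
  have e0 := hn 0
  have : ((k : ℂ) - k') * (2 * Real.pi * Complex.I) = 0 := by linear_combination e1 - e0
  have := (mul_eq_zero.1 this).resolve_right hpi
  exact_mod_cast sub_eq_zero.1 this

end HasWinding

/-- A continuous function without zeros on a closed strip which is periodic along the strip has
the same winding along both boundary lines. -/
lemma winding_eq_of_ne_zero_on_strip {F : ℂ → ℂ} {a : ℝ} (ha : 0 < a) (hF : Continuous F)
    (hper : ∀ ζ, F (ζ + 2 * Real.pi * Complex.I) = F ζ)
    (h0 : ∀ ζ : ℂ, |ζ.re| ≤ a → F ζ ≠ 0) {k₁ k₂ : ℤ}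
    (h₁ : HasWinding (fun θ : ℝ => F (a + θ * Complex.I)) k₁)
    (h₂ : HasWinding (fun θ : ℝ => F (-a + θ * Complex.I)) k₂) : k₁ = k₂ := by
  set P : ℝ × ℝ → ℂ := fun p => F (((max (-a) (min p.1 a) : ℝ) : ℂ) + p.2 * Complex.I) with hP
  have hPc : Continuous P := by rw [hP]; fun_prop
  have hP0 : ∀ p, P p ≠ 0 := fun p => by
    apply h0
    simp only [Complex.add_re, Complex.ofReal_re, Complex.mul_re, Complex.I_re, mul_zero,
      Complex.ofReal_im, Complex.I_im, mul_one, sub_self, add_zero]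
    rw [abs_le]
    exact ⟨le_max_left _ _, max_le (by linarith) (min_le_right _ _)⟩
  obtain ⟨f, -, hf⟩ := (Complex.isCoveringMapOn_exp.existsUnique_continuousMap_lifts
    (⟨P, hPc⟩ : C(ℝ × ℝ, ℂ)) (a₀ := 0) (Complex.exp_log (hP0 0)) (fun p => hP0 p)).exists
  have hfe : ∀ p, Complex.exp (f p) = P p := fun p => congrFun hf p
  have hn : ∀ p : ℝ × ℝ, ∃ n : ℤ,
      f (p.1, p.2 + 2 * Real.pi) - f p = n * (2 * Real.pi * Complex.I) := fun p => by
    have : Complex.exp (f (p.1, p.2 + 2 * Real.pi)) = Complex.exp (f p) := by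
      rw [hfe, hfe, hP]
      simp only
      rw [← hper (_ + p.2 * Complex.I)]; congr 1; push_cast; ring
    obtain ⟨n, hn⟩ := Complex.exp_eq_exp_iff_exists_int.1 this
    exact ⟨n, by rw [hn]; ring⟩
  choose n hn using hn
  have hpi : (2 * Real.pi * Complex.I : ℂ) ≠ 0 := by simp [Real.pi_ne_zero]
  have hnc : Continuous n := by
    have : Continuous fun θ => ((n θ : ℤ) : ℂ) := by
      have e : (fun θ => ((n θ : ℤ) : ℂ)) =
          fun p => (f (p.1, p.2 + 2 * Real.pi) - f p) / (2 * Real.pi * Complex.I) := by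
        funext θ; rw [hn, mul_div_cancel_right₀ _ hpi]
      rw [e]; fun_prop
    exact Int.isClosedEmbedding_coe_real.isEmbedding.continuous_iff.2
      (by simpa [Function.comp_def] using Complex.continuous_re.comp this)
  have hconst : ∀ p, n p = n 0 := fun p => PreconnectedSpace.constant inferInstance hnc
  have hw : ∀ x : ℝ, HasWinding (fun θ => P (x, θ)) (n 0) := fun x =>
    ⟨fun θ => f (x, θ), by fun_prop, fun θ => (hfe _).symm, fun θ => by
      have := hn (x, θ)
      rw [hconst] at this
      simp only at this
      linear_combination this⟩
  have w₁ := hw a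
  have w₂ := hw (-a)
  have e₁ : (fun θ => P (a, θ)) = fun θ : ℝ => F (a + θ * Complex.I) := by
    funext θ; simp [hP, (by linarith : -a ≤ a)]
  have e₂ : (fun θ => P (-a, θ)) = fun θ : ℝ => F (-a + θ * Complex.I) := by
    funext θ; simp [hP, (by linarith : -a ≤ a)]
  rw [e₁] at w₁
  rw [e₂] at w₂
  exact (h₁.unique w₁).trans (w₂.unique h₂)

/-- An injective real-linear endomorphism of the plane preserves winding numbers up to sign. -/
lemma HasWinding.exists_sign_comp_linear {A : ℂ →L[ℝ] ℂ} (hA : Function.Injective A) :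
    ∃ ε : ℤ, |ε| = 1 ∧ ∀ (h : ℝ → ℂ) (k : ℤ), HasWinding h k →
      HasWinding (fun θ => A (h θ)) (ε * k) := by
  set c : ℂ := (A 1 - Complex.I * A Complex.I) / 2 with hc
  set d : ℂ := (A 1 + Complex.I * A Complex.I) / 2 with hd
  have hAw : ∀ w, A w = c * w + d * (starRingEnd ℂ) w := fun w => by
    have e : A w = w.re * A 1 + w.im * A Complex.I := by
      conv_lhs => rw [show w = w.re • (1 : ℂ) + w.im • Complex.I by
        simp]
      rw [map_add, map_smul, map_smul]; simp
    have e1 : w = w.re + w.im * Complex.I := (Complex.re_add_im w).symm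
    have e2 : (starRingEnd ℂ) w = w.re - w.im * Complex.I := by
      apply Complex.ext <;> simp
    rw [e, e2, hc, hd]
    conv_rhs => rw [e1]
    simp only [Complex.add_re, Complex.ofReal_re, Complex.mul_re, Complex.I_re, mul_zero,
      Complex.ofReal_im, Complex.I_im, mul_one, sub_self, add_zero, Complex.add_im,
      Complex.mul_im, zero_add]
    linear_combination ((w.im : ℂ) * A Complex.I) * Complex.I_sq
  have hne : ‖c‖ ≠ ‖d‖ := fun hcd => by
    rcases eq_or_ne c 0 with h0 | h0
    · have hd0 : d = 0 := by simpa [h0] using hcd.symm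
      have : A 1 = A 0 := by rw [hAw, hAw, h0, hd0]; simp
      exact one_ne_zero (hA this)
    · obtain ⟨w, hw⟩ := IsAlgClosed.exists_pow_nat_eq (-d / c) (n := 2) (by norm_num)
      have hw1 : ‖w‖ = 1 := by
        have : ‖w‖ ^ 2 = 1 := by
          rw [← norm_pow, hw, norm_div, norm_neg, ← hcd, div_self (by simpa using h0)]
        nlinarith [norm_nonneg w]
      have hw0 : w ≠ 0 := by rintro rfl; simp at hw1
      have hww : w * (starRingEnd ℂ) w = 1 := by
        rw [Complex.mul_conj, Complex.normSq_eq_norm_sq, hw1]; simp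
      have : w * A w = 0 := by
        rw [hAw]
        have : c * w ^ 2 = -d := by rw [hw]; field_simp
        linear_combination this + d * hww
      have : A w = A 0 := by
        rw [map_zero]; exact (mul_eq_zero.1 this).resolve_left hw0
      exact hw0 (hA this)
  have cont : ∀ {h : ℝ → ℂ} {k : ℤ}, HasWinding h k → Continuous (fun θ => A (h θ)) :=
    fun H => A.continuous.comp H.continuous
  have per : ∀ {h : ℝ → ℂ} {k : ℤ}, HasWinding h k →
      ∀ θ, A (h (θ + 2 * Real.pi)) = A (h θ) := fun H θ => by rw [H.periodic]
  rcases hne.lt_or_gt with hlt | hlt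
  · have hd0 : d ≠ 0 := fun h => by
      rw [h, norm_zero] at hlt; exact (norm_nonneg c).not_gt hlt
    refine ⟨-1, by simp, fun h k H => ?_⟩
    have := (HasWinding.const hd0).mul H.conj
    rw [zero_add, ← neg_one_mul] at this
    refine this.of_re_pos (cont H) (per H) fun θ => ?_
    have hw := H.ne_zero θ
    set w := h θ
    rw [hAw, add_mul, Complex.add_re, Complex.mul_conj, Complex.ofReal_re,
      Complex.normSq_eq_norm_sq, norm_mul, RCLike.norm_conj]
    have b : -(‖c‖ * ‖d‖ * ‖w‖ ^ 2) ≤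
        (c * w * (starRingEnd ℂ) (d * (starRingEnd ℂ) w)).re := by
      refine (abs_le.1 ((Complex.abs_re_le_norm _).trans_eq ?_)).1
      simp; ring
    have : 0 < ‖w‖ ^ 2 := by positivity
    have : 0 < ‖d‖ * (‖d‖ - ‖c‖) * ‖w‖ ^ 2 :=
      mul_pos (mul_pos (by positivity) (by linarith)) this
    nlinarith
  · have hc0 : c ≠ 0 := fun h => by
      rw [h, norm_zero] at hlt; exact (norm_nonneg d).not_gt hlt
    refine ⟨1, by simp, fun h k H => ?_⟩
    have := (HasWinding.const hc0).mul H
    rw [zero_add, ← one_mul k] at this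
    refine this.of_re_pos (cont H) (per H) fun θ => ?_
    have hw := H.ne_zero θ
    set w := h θ
    rw [hAw, add_mul, Complex.add_re, Complex.mul_conj, Complex.ofReal_re,
      Complex.normSq_eq_norm_sq, norm_mul]
    have b : -(‖c‖ * ‖d‖ * ‖w‖ ^ 2) ≤
        (d * (starRingEnd ℂ) w * (starRingEnd ℂ) (c * w)).re := by
      refine (abs_le.1 ((Complex.abs_re_le_norm _).trans_eq ?_)).1
      simp; ring
    have : 0 < ‖w‖ ^ 2 := by positivity
    have : 0 < ‖c‖ * (‖c‖ - ‖d‖) * ‖w‖ ^ 2 :=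
      mul_pos (mul_pos (by positivity) (by linarith)) this
    nlinarith

/-- The winding of the `2πi`-periodic function `ζ ↦ A (exp (ζ - z) - 1)`, with `A` real-linear and
injective, changes by `±1` across its only line of zeros. -/
lemma hasWinding_linear_exp_sub_one {A : ℂ →L[ℝ] ℂ} (hA : Function.Injective A) {z : ℂ} {a : ℝ}
    (hz : |z.re| < a) : ∃ ε : ℤ, |ε| = 1 ∧
      HasWinding (fun θ : ℝ => A (Complex.exp (a + θ * Complex.I - z) - 1)) ε ∧
      HasWinding (fun θ : ℝ => A (Complex.exp (-a + θ * Complex.I - z) - 1)) 0 := by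
  obtain ⟨ε, hε, H⟩ := HasWinding.exists_sign_comp_linear hA
  have hper : ∀ (c : ℂ) (θ : ℝ), Complex.exp (c + (θ + 2 * Real.pi : ℝ) * Complex.I - z) - 1
      = Complex.exp (c + θ * Complex.I - z) - 1 := fun c θ => by
    rw [show c + (θ + 2 * Real.pi : ℝ) * Complex.I - z
      = c + θ * Complex.I - z + 2 * Real.pi * Complex.I by push_cast; ring,
      Complex.exp_periodic]
  refine ⟨ε, hε, ?_, ?_⟩
  · have h1 : HasWinding (fun θ : ℝ => Complex.exp (a + θ * Complex.I - z)) 1 := by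
      have := (HasWinding.const (Complex.exp_ne_zero (a - z))).mul HasWinding.exp_mul_I
      rw [zero_add] at this
      convert this using 2 with θ
      rw [← Complex.exp_add]; congr 1; ring
    rw [← mul_one ε]
    refine H _ _ (h1.of_re_pos (by fun_prop) (hper _) fun θ => ?_)
    have hE : 1 < ‖Complex.exp (a + θ * Complex.I - z)‖ := by
      rw [Complex.norm_exp]
      simpa using (abs_lt.1 hz).2
    set E := Complex.exp (a + θ * Complex.I - z)
    rw [sub_mul, one_mul, Complex.mul_conj, Complex.normSq_eq_norm_sq]
    have := Complex.re_le_norm E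
    simp only [Complex.sub_re, Complex.ofReal_re, Complex.conj_re]
    nlinarith
  · rw [← mul_zero ε]
    refine H _ _ ((HasWinding.const (c := -1) (by simp)).of_re_pos (by fun_prop) (hper _)
      fun θ => ?_)
    have hE : ‖Complex.exp (-a + θ * Complex.I - z)‖ < 1 := by
      rw [Complex.norm_exp]
      have := (abs_lt.1 hz).1
      simp; linarith
    set E := Complex.exp (-a + θ * Complex.I - z)
    have := Complex.re_le_norm E
    simp
    linarith

/-- Near a zero `z` with injective derivative `A`, a function is asymptotic to
`A (exp (ζ - z) - 1)`. -/
lemma tendsto_div_linear_exp_sub_one {F : ℂ → ℂ} {A : ℂ →L[ℝ] ℂ} {z : ℂ}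
    (hA : Function.Injective A) (hF : HasFDerivAt F A z) (hz : F z = 0) :
    Filter.Tendsto (fun ζ => F ζ / A (Complex.exp (ζ - z) - 1)) (nhdsWithin z {z}ᶜ) (nhds 1) := by
  have hM : HasFDerivAt (fun ζ => A (Complex.exp (ζ - z) - 1)) A z := by
    have h1 : HasDerivAt (fun ζ => Complex.exp (ζ - z) - 1) 1 z := by
      simpa using (((hasDerivAt_id z).sub_const z).cexp).sub_const 1
    have h2 := A.hasFDerivAt.comp z (h1.hasFDerivAt.restrictScalars ℝ)
    have e : A ∘SL ContinuousLinearMap.restrictScalars ℝ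
        (ContinuousLinearMap.toSpanSingleton ℂ (1 : ℂ)) = A := by ext; simp
    rw [e] at h2
    exact h2
  obtain ⟨K, hK, hAK⟩ := (A : ℂ →ₗ[ℝ] ℂ).exists_antilipschitzWith
    (LinearMap.ker_eq_bot.2 hA)
  have hbig : (fun ζ => ζ - z) =O[nhds z] fun ζ => A (ζ - z) := by
    refine Asymptotics.IsBigO.of_bound K (Filter.Eventually.of_forall fun ζ => ?_)
    simpa [dist_eq_norm] using hAK.le_mul_dist (ζ - z) 0
  have hFo : (fun ζ => F ζ - A (ζ - z)) =o[nhds z] fun ζ => A (ζ - z) := by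
    have := hF.isLittleO
    simp only [hz, sub_zero] at this
    exact this.trans_isBigO hbig
  have hMo : (fun ζ => A (Complex.exp (ζ - z) - 1) - A (ζ - z)) =o[nhds z]
      fun ζ => A (ζ - z) := by
    have := hM.isLittleO
    simp only [sub_self, Complex.exp_zero, map_zero, sub_zero] at this
    exact this.trans_isBigO hbig
  have hequiv : Asymptotics.IsEquivalent (nhds z) F fun ζ => A (Complex.exp (ζ - z) - 1) :=
    Asymptotics.IsEquivalent.trans hFo (Asymptotics.IsEquivalent.symm hMo)
  have hne : ∀ᶠ ζ in nhdsWithin z {z}ᶜ, A (Complex.exp (ζ - z) - 1) ≠ 0 := by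
    have := hMo.def (show (0:ℝ) < 1/2 by norm_num)
    filter_upwards [nhdsWithin_le_nhds this, self_mem_nhdsWithin] with ζ h1 h2 h3
    rw [h3, zero_sub, norm_neg] at h1
    have : A (ζ - z) = A 0 := by
      rw [map_zero, ← norm_eq_zero]; linarith [norm_nonneg (A (ζ - z))]
    exact h2 (sub_eq_zero.1 (hA this))
  exact (Asymptotics.isEquivalent_iff_tendsto_one hne).1 (hequiv.mono nhdsWithin_le_nhds)

/-- Lower bound for the number of zeros in a strip, modulo the period `2πi`, of a periodic
function with nondegenerate zeros. -/
lemma winding_sub_le_card_zeros {a : ℝ} (ha : 0 < a) (Z : Finset ℂ) :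
    ∀ (F : ℂ → ℂ) (k₁ k₂ : ℤ), Continuous F →
    (∀ ζ, F (ζ + 2 * Real.pi * Complex.I) = F ζ) →
    (∀ z ∈ Z, |z.re| < a) →
    (∀ z ∈ Z, ∀ z' ∈ Z, Complex.exp z = Complex.exp z' → z = z') →
    (∀ ζ : ℂ, |ζ.re| ≤ a → F ζ = 0 → ∃ z ∈ Z, Complex.exp ζ = Complex.exp z) →
    (∀ z ∈ Z, F z = 0 ∧ ∃ A : ℂ →L[ℝ] ℂ, Function.Injective A ∧ HasFDerivAt F A z) →
    HasWinding (fun θ : ℝ => F (a + θ * Complex.I)) k₁ →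
    HasWinding (fun θ : ℝ => F (-a + θ * Complex.I)) k₂ →
    |k₁ - k₂| ≤ Z.card := by
  classical
  induction Z using Finset.induction_on with
  | empty =>
    intro F k₁ k₂ hF hper _ _ h0 _ h₁ h₂
    rw [winding_eq_of_ne_zero_on_strip ha hF hper (fun ζ hζ h => by simpa using h0 ζ hζ h) h₁ h₂]
    simp
  | insert z Z hzZ ih =>
    intro F k₁ k₂ hF hper hre hinj h0 hder h₁ h₂
    obtain ⟨hFz, A, hA, hFA⟩ := hder z (Finset.mem_insert_self _ _)
    obtain ⟨ε, hε, w₁, w₂⟩ := hasWinding_linear_exp_sub_one hA (hre z (Finset.mem_insert_self _ _))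
    set M : ℂ → ℂ := fun ζ => A (Complex.exp (ζ - z) - 1) with hM
    have hM0 : ∀ ζ, M ζ = 0 ↔ Complex.exp ζ = Complex.exp z := fun ζ => by
      rw [hM]
      simp only
      rw [← map_zero A, hA.eq_iff, sub_eq_zero, Complex.exp_sub,
        div_eq_one_iff_eq (Complex.exp_ne_zero _)]
    have hMper : ∀ ζ, M (ζ + 2 * Real.pi * Complex.I) = M ζ := fun ζ => by
      simp only [hM]
      rw [show ζ + 2 * Real.pi * Complex.I - z = ζ - z + 2 * Real.pi * Complex.I by ring,
        Complex.exp_periodic]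
    have hMc : Continuous M := by rw [hM]; fun_prop
    set H : ℂ → ℂ := fun ζ => if M ζ = 0 then 1 else F ζ / M ζ with hH
    have hHper : Function.Periodic H (2 * Real.pi * Complex.I) := fun ζ => by
      simp only [hH, hMper, hper]
    have hH1 : ∀ {ζ}, M ζ ≠ 0 → H =ᶠ[nhds ζ] fun ζ => F ζ / M ζ := fun {ζ} h => by
      filter_upwards [hMc.continuousAt.eventually_ne h] with ξ hξ
      simp [hH, hξ]
    have hHz : ContinuousAt H z := by
      have hMz : M z = 0 := by rw [hM0]
      rw [continuousAt_iff_punctured_nhds]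
      have : H z = 1 := by simp [hH, hMz]
      rw [this]
      refine (tendsto_div_linear_exp_sub_one hA hFA hFz).congr' ?_
      have hball : ∀ᶠ ζ in nhdsWithin z {z}ᶜ, ‖ζ - z‖ < 1 :=
        nhdsWithin_le_nhds <| by
          filter_upwards [Metric.ball_mem_nhds z zero_lt_one] with ζ h
          simpa [dist_eq_norm] using h
      filter_upwards [hball, self_mem_nhdsWithin] with ζ hζ hζ'
      have : M ζ ≠ 0 := fun h => by
        rw [hM0, Complex.exp_eq_exp_iff_exists_int] at h
        obtain ⟨n, rfl⟩ := h
        have hn : n ≠ 0 := by rintro rfl; simp at hζ'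
        have hn1 : (1:ℝ) ≤ |(n:ℝ)| := by exact_mod_cast Int.one_le_abs hn
        have : ‖z + n * (2 * Real.pi * Complex.I) - z‖ = |(n:ℝ)| * (2 * Real.pi) := by
          simp [abs_of_pos Real.pi_pos]
        rw [this] at hζ
        nlinarith [Real.pi_gt_three]
      rw [hH]
      exact (if_neg this).symm
    have hHc : Continuous H := by
      rw [continuous_iff_continuousAt]
      intro ζ
      by_cases h : M ζ = 0
      · rw [hM0, Complex.exp_eq_exp_iff_exists_int] at h
        obtain ⟨n, rfl⟩ := h
        have hn : H = fun ξ => H (ξ - n * (2 * Real.pi * Complex.I)) := by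
          funext ξ; exact (hHper.sub_int_mul_eq n).symm
        rw [hn]
        refine ContinuousAt.comp (g := H) ?_ (by fun_prop)
        simpa using hHz
      · exact ((hF.continuousAt.div hMc.continuousAt h).congr (hH1 h).symm)
    have hMd : ∀ ζ, DifferentiableAt ℝ M ζ := fun ζ => by
      have h1 : DifferentiableAt ℝ (fun ζ => Complex.exp (ζ - z) - 1) ζ := by fun_prop
      exact A.differentiableAt.comp ζ h1
    have hMb : ∀ {ζ : ℂ}, |ζ.re| = a → M ζ ≠ 0 := fun {ζ} hζ h => by
      rw [hM0, Complex.exp_eq_exp_iff_exists_int] at h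
      obtain ⟨n, rfl⟩ := h
      have := hre z (Finset.mem_insert_self _ _)
      simp at hζ
      exact this.ne hζ
    have hcard := ih H (k₁ - ε) (k₂ - 0) hHc hHper
      (fun z' h => hre z' (Finset.mem_insert_of_mem h))
      (fun x hx y hy => hinj x (Finset.mem_insert_of_mem hx) y (Finset.mem_insert_of_mem hy))
      (fun ζ hζ h => by
        by_cases hm : M ζ = 0
        · simp [hH, hm] at h
        · have hf : F ζ = 0 := by
            simp only [hH, hm, if_false, div_eq_zero_iff, or_false] at h
            exact h
          obtain ⟨z', h1, h2⟩ := h0 ζ hζ hf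
          rcases Finset.mem_insert.1 h1 with rfl | h1
          · exact absurd ((hM0 ζ).2 h2) hm
          · exact ⟨z', h1, h2⟩)
      (fun z' hz' => by
        obtain ⟨hf, B, hB, hFB⟩ := hder z' (Finset.mem_insert_of_mem hz')
        have hm : M z' ≠ 0 := fun h => by
          have := hinj _ (Finset.mem_insert_of_mem hz') _ (Finset.mem_insert_self _ _)
            ((hM0 z').1 h)
          exact hzZ (this ▸ hz')
        refine ⟨by simp [hH, hm, hf], (M z')⁻¹ • B, fun x y hxy => hB ?_, ?_⟩
        · simpa [hm] using hxy
        · obtain ⟨D, hD⟩ := (hMd z').inv hm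
          have := hFB.mul hD
          rw [hf, zero_smul, zero_add] at this
          refine HasFDerivAt.congr_of_eventuallyEq ?_ (hH1 hm)
          simp only [div_eq_mul_inv]
          exact this)
      (by
        have := h₁.mul w₁.inv
        rw [← sub_eq_add_neg] at this
        convert this using 2 with θ
        have : M (a + θ * Complex.I) ≠ 0 := hMb (by simp [ha.le])
        exact (if_neg this).trans (div_eq_mul_inv _ _))
      (by
        have := h₂.mul w₂.inv
        rw [← sub_eq_add_neg] at this
        convert this using 2 with θ
        have : M (-a + θ * Complex.I) ≠ 0 := hMb (by simp [ha.le])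
        exact (if_neg this).trans (div_eq_mul_inv _ _))
    rw [Finset.card_insert_of_notMem hzZ]
    rw [sub_zero] at hcard
    push_cast
    have : |k₁ - k₂| ≤ |k₁ - ε - k₂| + |ε| := by
      have := abs_add_le (k₁ - ε - k₂) ε
      rwa [show k₁ - ε - k₂ + ε = k₁ - k₂ by ring] at this
    linarith

/-- The quadrilinear form on `R³` with coefficient array `C`. -/
def quadForm {R : Type*} [CommRing R] (C : Fin 3 → Fin 3 → Fin 3 → Fin 3 → R)
    (a b c d : Fin 3 → R) : R :=
  ∑ i, ∑ j, ∑ k, ∑ l, C i j k l * a i * b j * c k * d l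

/-- Symmetry of an array of coefficients under permutations of its four indices. -/
def IsSymmArray {R : Type*} (C : Fin 3 → Fin 3 → Fin 3 → Fin 3 → R) : Prop :=
  (∀ i j k l, C i j k l = C j i k l) ∧ (∀ i j k l, C i j k l = C i k j l) ∧
    ∀ i j k l, C i j k l = C i j l k

/-- Complexification of a real array of coefficients. -/
def carray (C : Fin 3 → Fin 3 → Fin 3 → Fin 3 → ℝ) : Fin 3 → Fin 3 → Fin 3 → Fin 3 → ℂ :=
  fun i j k l => (C i j k l : ℂ)

section quadForm

lemma IsSymmArray.map_carray {C : Fin 3 → Fin 3 → Fin 3 → Fin 3 → ℝ} (h : IsSymmArray C) :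
    IsSymmArray (carray C) :=
  ⟨fun i j k l => congrArg _ (h.1 i j k l), fun i j k l => congrArg _ (h.2.1 i j k l),
    fun i j k l => congrArg _ (h.2.2 i j k l)⟩

lemma quadForm_cvec (C : Fin 3 → Fin 3 → Fin 3 → Fin 3 → ℝ) (a b c d : Fin 3 → ℝ) :
    quadForm (carray C) (cvec a) (cvec b) (cvec c) (cvec d) = ((quadForm C a b c d : ℝ) : ℂ) := by
  simp [quadForm, carray, cvec]

variable {R : Type*} [CommRing R] {C : Fin 3 → Fin 3 → Fin 3 → Fin 3 → R}

lemma quadForm_swap₁ (h : IsSymmArray C) (a b c d : Fin 3 → R) :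
    quadForm C a b c d = quadForm C b a c d := by
  unfold quadForm
  rw [Finset.sum_comm]
  refine Finset.sum_congr rfl fun i _ => Finset.sum_congr rfl fun j _ =>
    Finset.sum_congr rfl fun k _ => Finset.sum_congr rfl fun l _ => ?_
  rw [h.1 j i]; ring

lemma quadForm_swap₂ (h : IsSymmArray C) (a b c d : Fin 3 → R) :
    quadForm C a b c d = quadForm C a c b d := by
  unfold quadForm
  refine Finset.sum_congr rfl fun i _ => ?_
  rw [Finset.sum_comm]
  refine Finset.sum_congr rfl fun j _ =>
    Finset.sum_congr rfl fun k _ => Finset.sum_congr rfl fun l _ => ?_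
  rw [h.2.1 i k j]; ring

lemma quadForm_swap₃ (h : IsSymmArray C) (a b c d : Fin 3 → R) :
    quadForm C a b c d = quadForm C a b d c := by
  unfold quadForm
  refine Finset.sum_congr rfl fun i _ => Finset.sum_congr rfl fun j _ => ?_
  rw [Finset.sum_comm]
  refine Finset.sum_congr rfl fun k _ => Finset.sum_congr rfl fun l _ => ?_
  rw [h.2.2 i j l k]; ring

lemma quadForm_add_smul (x y : R) (a a' b c d : Fin 3 → R) :
    quadForm C (x • a + y • a') b c d = x * quadForm C a b c d + y * quadForm C a' b c d := by
  simp only [quadForm, Finset.mul_sum, ← Finset.sum_add_distrib]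
  refine Finset.sum_congr rfl fun i _ => Finset.sum_congr rfl fun j _ =>
    Finset.sum_congr rfl fun k _ => Finset.sum_congr rfl fun l _ => ?_
  simp only [Pi.add_apply, Pi.smul_apply, smul_eq_mul]; ring

lemma quadForm_add_smul₂ (h : IsSymmArray C) (x y : R) (a a' b c d : Fin 3 → R) :
    quadForm C b (x • a + y • a') c d = x * quadForm C b a c d + y * quadForm C b a' c d := by
  rw [quadForm_swap₁ h, quadForm_add_smul, quadForm_swap₁ h a, quadForm_swap₁ h a']

lemma quadForm_add_smul₃ (h : IsSymmArray C) (x y : R) (a a' b c d : Fin 3 → R) :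
    quadForm C b c (x • a + y • a') d = x * quadForm C b c a d + y * quadForm C b c a' d := by
  rw [quadForm_swap₂ h, quadForm_add_smul₂ h, quadForm_swap₂ h b a, quadForm_swap₂ h b a']

lemma quadForm_add_smul₄ (h : IsSymmArray C) (x y : R) (a a' b c d : Fin 3 → R) :
    quadForm C b c d (x • a + y • a') = x * quadForm C b c d a + y * quadForm C b c d a' := by
  rw [quadForm_swap₃ h, quadForm_add_smul₃ h, quadForm_swap₃ h b c a, quadForm_swap₃ h b c a']

lemma quadForm_mixed_expand (h : IsSymmArray C) (x y : R) (a b N : Fin 3 → R) :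
    quadForm C N (x • a + y • b) (x • a + y • b) (x • a + y • b) =
      quadForm C N a a a * x ^ 3 + 3 * quadForm C N a a b * x ^ 2 * y
        + 3 * quadForm C N a b b * x * y ^ 2 + quadForm C N b b b * y ^ 3 := by
  simp only [quadForm_add_smul₂ h, quadForm_add_smul₃ h, quadForm_add_smul₄ h]
  rw [quadForm_swap₂ h N b a a, quadForm_swap₃ h N a b a, quadForm_swap₂ h N b a b,
    quadForm_swap₃ h N b b a, quadForm_swap₂ h N b a b]
  ring

/-- The binary quartic cut out on the plane spanned by `a` and `b`. -/
lemma quadForm_expand (h : IsSymmArray C) (x y : R) (a b : Fin 3 → R) :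
    quadForm C (x • a + y • b) (x • a + y • b) (x • a + y • b) (x • a + y • b) =
      quadForm C a a a a * x ^ 4 + 4 * quadForm C a a a b * x ^ 3 * y
        + 6 * quadForm C a a b b * x ^ 2 * y ^ 2 + 4 * quadForm C a b b b * x * y ^ 3
        + quadForm C b b b b * y ^ 4 := by
  rw [quadForm_add_smul, quadForm_mixed_expand h, quadForm_mixed_expand h,
    quadForm_swap₁ h b a a a, quadForm_swap₂ h a b a a, quadForm_swap₃ h a a b a,
    quadForm_swap₁ h b a a b, quadForm_swap₂ h a b a b,
    quadForm_swap₁ h b a b b]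
  ring

end quadForm

section polarization

variable {K : Type*} [Field K] {σ : Type*}

lemma pderiv_pderiv_comm (i j : σ) (g : MvPolynomial σ K) :
    pderiv i (pderiv j g) = pderiv j (pderiv i g) := by
  classical
  have : ⁅(pderiv i : Derivation K (MvPolynomial σ K) (MvPolynomial σ K)),
      (pderiv j : Derivation K (MvPolynomial σ K) (MvPolynomial σ K))⁆ = 0 := by
    apply MvPolynomial.derivation_ext
    intro k
    simp [Derivation.commutator_apply, pderiv_X, Pi.single_apply, apply_ite]
  have := congrArg (fun D => D g) this
  simpa [Derivation.commutator_apply, sub_eq_zero] using this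

lemma euler_eval [Fintype σ] {n : ℕ} {g : MvPolynomial σ K} (hg : g.IsHomogeneous n) (p : σ → K) :
    ∑ i, p i * eval p (pderiv i g) = n * eval p g := by
  have := congrArg (eval p) hg.sum_X_mul_pderiv
  simpa using this

lemma eval_pderiv₃_const {g : MvPolynomial σ K} (hg : g.IsHomogeneous 4) (i j k l : σ)
    (p : σ → K) :
    eval p (pderiv l (pderiv k (pderiv j (pderiv i g)))) =
      constantCoeff (pderiv l (pderiv k (pderiv j (pderiv i g)))) := by
  have h : (pderiv l (pderiv k (pderiv j (pderiv i g)))).IsHomogeneous 0 := by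
    have := hg.pderiv (i := i) |>.pderiv (i := j) |>.pderiv (i := k) |>.pderiv (i := l)
    simpa using this
  rw [← totalDegree_zero_iff_isHomogeneous, totalDegree_eq_zero_iff_eq_C] at h
  conv_lhs => rw [h]
  simp [constantCoeff_eq]

/-- The array of fourth derivatives, normalized to be the polarization of a quartic form. -/
def polarArray (g : MvPolynomial (Fin 3) K) (i j k l : Fin 3) : K :=
  constantCoeff (pderiv l (pderiv k (pderiv j (pderiv i g)))) / 24

lemma isSymmArray_polarArray (g : MvPolynomial (Fin 3) K) : IsSymmArray (polarArray g) := by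
  refine ⟨fun i j k l => ?_, fun i j k l => ?_, fun i j k l => ?_⟩ <;> unfold polarArray
  · rw [pderiv_pderiv_comm j i]
  · rw [pderiv_pderiv_comm k j]
  · rw [pderiv_pderiv_comm l k]

lemma sum_polarArray_mul [CharZero K] {g : MvPolynomial (Fin 3) K} (hg : g.IsHomogeneous 4)
    (i : Fin 3) (p : Fin 3 → K) :
    4 * ∑ j, ∑ k, ∑ l, polarArray g i j k l * p j * p k * p l = eval p (pderiv i g) := by
  have e2 := euler_eval (hg.pderiv (i := i)) p
  have e3 := fun j => euler_eval ((hg.pderiv (i := i)).pderiv (i := j)) p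
  have e4 := fun j k =>
    euler_eval (((hg.pderiv (i := i)).pderiv (i := j)).pderiv (i := k)) p
  norm_num at e2 e3 e4
  simp only [eval_pderiv₃_const hg] at e4
  have : (24 : K) * ∑ j, ∑ k, ∑ l, polarArray g i j k l * p j * p k * p l =
      6 * eval p (pderiv i g) := by
    calc _ = ∑ j, p j * ∑ k, p k * ∑ l, p l *
          constantCoeff (pderiv l (pderiv k (pderiv j (pderiv i g)))) := by
          simp only [polarArray, Finset.mul_sum]
          refine Finset.sum_congr rfl fun j _ =>
            Finset.sum_congr rfl fun k _ => Finset.sum_congr rfl fun l _ => ?_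
          ring
      _ = 2 * ∑ j, p j * eval p (pderiv j (pderiv i g)) := by
          simp only [e4, e3, Finset.mul_sum]
          exact Finset.sum_congr rfl fun j _ => by ring
      _ = _ := by rw [e2]; ring
  linear_combination this / 6

lemma quadForm_polarArray [CharZero K] {g : MvPolynomial (Fin 3) K} (hg : g.IsHomogeneous 4)
    (p : Fin 3 → K) : quadForm (polarArray g) p p p p = eval p g := by
  have e1 := euler_eval hg p
  simp only [← sum_polarArray_mul hg] at e1
  have : quadForm (polarArray g) p p p p =
      ∑ i, p i * ∑ j, ∑ k, ∑ l, polarArray g i j k l * p j * p k * p l := by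
    simp only [quadForm, Finset.mul_sum]
    refine Finset.sum_congr rfl fun i _ => Finset.sum_congr rfl fun j _ =>
      Finset.sum_congr rfl fun k _ => Finset.sum_congr rfl fun l _ => ?_
    ring
  have h4 : ∑ i, p i * (4 * ∑ j, ∑ k, ∑ l, polarArray g i j k l * p j * p k * p l) =
      4 * quadForm (polarArray g) p p p p := by
    rw [this, Finset.mul_sum]
    exact Finset.sum_congr rfl fun i _ => by ring
  rw [h4] at e1
  exact mul_left_cancel₀ (by norm_num : (4 : K) ≠ 0) (by exact_mod_cast e1)

lemma quadForm_polarArray_single [CharZero K] {g : MvPolynomial (Fin 3) K}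
    (hg : g.IsHomogeneous 4) (i : Fin 3) (p : Fin 3 → K) :
    4 * quadForm (polarArray g) (Pi.single i 1) p p p = eval p (pderiv i g) := by
  rw [← sum_polarArray_mul hg, quadForm, Finset.sum_eq_single i]
  · simp
  · intro j _ hj
    simp [hj]
  · simp

end polarization

lemma polarArray_cmap (f : MvPolynomial (Fin 3) ℝ) :
    polarArray (cmap f) = carray (polarArray f) := by
  funext i j k l
  simp [polarArray, carray, cmap, pderiv_map, constantCoeff_map]

lemma isHomogeneous_cmap {f : MvPolynomial (Fin 3) ℝ} (hf : f.IsHomogeneous 4) :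
    (cmap f).IsHomogeneous 4 :=
  hf.map _

lemma cev_eq_quadForm {f : MvPolynomial (Fin 3) ℝ} (hf : f.IsHomogeneous 4) (p : Fin 3 → ℂ) :
    cev f p = quadForm (carray (polarArray f)) p p p p := by
  rw [← polarArray_cmap, quadForm_polarArray (isHomogeneous_cmap hf)]; rfl

/-- A point of a smooth quartic at which the polar form vanishes in three independent directions
does not exist. -/
lemma SmoothQuartic.exists_quadForm_single_ne_zero {f : MvPolynomial (Fin 3) ℝ}
    (hf : f.IsHomogeneous 4) (hsm : SmoothQuartic f) {p : Fin 3 → ℂ} (hp : p ≠ 0) :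
    ∃ i, quadForm (carray (polarArray f)) (Pi.single i 1) p p p ≠ 0 := by
  by_contra! h
  have h0 : cev f p = 0 := by
    have := euler_eval (isHomogeneous_cmap hf) p
    simp only [← quadForm_polarArray_single (isHomogeneous_cmap hf)] at this
    simp only [polarArray_cmap, h] at this
    simpa [cev] using this.symm
  obtain ⟨i, hi⟩ := hsm p hp h0
  rw [← quadForm_polarArray_single (isHomogeneous_cmap hf)] at hi
  rw [polarArray_cmap, h, mul_zero] at hi
  exact hi rfl

section bitangent

open Matrix

lemma lin_smul_left {R : Type*} [CommSemiring R] (t : R) (ℓ p : Fin 3 → R) :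
    lin (t • ℓ) p = t * lin ℓ p := by
  simp [lin, Finset.mul_sum, mul_assoc]

lemma cvec_smul (t : ℝ) (v : Fin 3 → ℝ) : cvec (t • v) = (t : ℂ) • cvec v := by
  funext i; simp [cvec]

lemma cvec_cross (a b : Fin 3 → ℝ) : cvec (a ⨯₃ b) = cvec a ⨯₃ cvec b := by
  funext i; fin_cases i <;> simp [cvec, cross_apply]

lemma lin_cvec (a b : Fin 3 → ℝ) : lin (cvec a) (cvec b) = ((lin a b : ℝ) : ℂ) := by
  simp [lin, cvec]

lemma lin_self_ne_zero {a : Fin 3 → ℝ} (ha : a ≠ 0) : lin a a ≠ 0 := by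
  have : lin a a = a ⬝ᵥ a := rfl
  rw [this]
  exact fun h => ha (dotProduct_self_eq_zero.mp h)

/-- The quartic form `quadForm C` restricted to the plane spanned by `a` and `b`, in the
coordinates `x • a + y • b`, is `K * (x ^ 2 + u * x * y + v * y ^ 2) ^ 2`. -/
structure IsSquareOn (C : Fin 3 → Fin 3 → Fin 3 → Fin 3 → ℝ) (a b : Fin 3 → ℝ) (K u v : ℝ) :
    Prop where
  coeff₄ : quadForm C a a a a = K
  coeff₃ : 4 * quadForm C a a a b = K * (2 * u)
  coeff₂ : 6 * quadForm C a a b b = K * (u ^ 2 + 2 * v)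
  coeff₁ : 4 * quadForm C a b b b = K * (2 * u * v)
  coeff₀ : quadForm C b b b b = K * v ^ 2

/-- A nonzero square form with real coefficients on the plane spanned by `a` and `b` gives a
real bitangent. -/
lemma mk_cross_mem_realBitangents {f : MvPolynomial (Fin 3) ℝ} (hf : f.IsHomogeneous 4)
    {a b : Fin 3 → ℝ} (hab : a ⨯₃ b ≠ 0) {K u v : ℝ} (hK : K ≠ 0)
    (H : IsSquareOn (polarArray f) a b K u v) :
    Projectivization.mk ℝ (a ⨯₃ b) hab ∈ realBitangents f := by
  obtain ⟨h4, h3, h2, h1, h0⟩ := H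
  obtain ⟨t, ht⟩ := Projectivization.exists_smul_eq_mk_rep ℝ (a ⨯₃ b) hab
  have ht0 : ((t : ℝ) : ℂ) ≠ 0 := by exact_mod_cast t.ne_zero
  obtain ⟨r, s, hrs, hrs'⟩ : ∃ r s : ℂ, r + s = u ∧ r * s = v := by
    obtain ⟨d, hd⟩ := IsAlgClosed.exists_eq_mul_self ((u : ℂ) ^ 2 - 4 * v)
    exact ⟨(u + d) / 2, (u - d) / 2, by ring, by linear_combination hd / 4⟩
  set A := cvec a with hA
  set B := cvec b with hB
  set N := A ⨯₃ B with hN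
  set Δ := lin N N with hΔ
  have hN' : cvec (a ⨯₃ b) = N := cvec_cross a b
  have hΔ0 : Δ ≠ 0 := by
    rw [hΔ, ← hN', lin_cvec]
    exact_mod_cast lin_self_ne_zero hab
  have hsq : ∀ x y : ℂ, cev f (x • A + y • B) = K * ((x + r * y) * (x + s * y)) ^ 2 := by
    intro x y
    rw [cev_eq_quadForm hf, quadForm_expand (isSymmArray_polarArray f).map_carray]
    simp only [hA, hB, quadForm_cvec]
    have h3' := congrArg (Complex.ofReal) h3
    have h2' := congrArg (Complex.ofReal) h2
    have h1' := congrArg (Complex.ofReal) h1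
    have h0' := congrArg (Complex.ofReal) h0
    push_cast at h3' h2' h1' h0'
    rw [h4, h3', h2', h1', h0', ← hrs, ← hrs']
    ring
  have hrep : cvec (Projectivization.mk ℝ (a ⨯₃ b) hab).rep = ((t : ℝ) : ℂ) • N := by
    rw [← ht, ← hN']; exact cvec_smul _ _
  have e1 : lin (B ⨯₃ N) A = Δ := by
    simp [hΔ, hN, lin, Fin.sum_univ_three, cross_apply]; ring
  have e2 : lin (B ⨯₃ N) B = 0 := by
    simp [lin, Fin.sum_univ_three, cross_apply]; ring
  have e3 : lin (N ⨯₃ A) A = 0 := by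
    simp [lin, Fin.sum_univ_three, cross_apply]; ring
  have e4 : lin (N ⨯₃ A) B = Δ := by
    simp [hΔ, hN, lin, Fin.sum_univ_three, cross_apply]; ring
  have e5 : lin N A = 0 := by
    simp [hN, lin, Fin.sum_univ_three, cross_apply]; ring
  have e6 : lin N B = 0 := by
    simp [hN, lin, Fin.sum_univ_three, cross_apply]; ring
  have cramer : ∀ p, Δ • p = lin (B ⨯₃ N) p • A + lin (N ⨯₃ A) p • B + lin N p • N := by
    intro p
    funext i
    fin_cases i <;> simp [hΔ, hN, lin, Fin.sum_univ_three, cross_apply] <;> ring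
  have ladd : ∀ m n p : Fin 3 → ℂ, ∀ x : ℂ, lin (m + x • n) p = lin m p + x * lin n p := by
    intro m n p x
    simp [lin, Fin.sum_univ_three]; ring
  have radd : ∀ m p q : Fin 3 → ℂ, ∀ x : ℂ, lin m (x • p + q) = x * lin m p + lin m q := by
    intro m p q x
    simp [lin, Fin.sum_univ_three]; ring
  have hNz : ∀ x : ℂ, (-x) • A + B ≠ 0 := by
    intro x hx
    have := radd (N ⨯₃ A) A B (-x)
    rw [hx, e3, e4] at this
    exact hΔ0 (by simpa [lin] using this.symm)
  change IsBitangent f (cvec _)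
  rw [hrep]
  refine ⟨(-r) • A + B, (-s) • A + B, ?_, hNz r, hNz s, ?_, ?_, (B ⨯₃ N) + r • (N ⨯₃ A),
    (B ⨯₃ N) + s • (N ⨯₃ A), K / Δ ^ 4, ?_, ?_, ?_, ⟨A, ?_, ?_⟩, ⟨A, ?_, ?_⟩, ?_⟩
  · refine smul_ne_zero ht0 fun h => hΔ0 ?_
    simp [hΔ, h, lin]
  · rw [lin_smul_left, radd, e5, e6]; simp
  · rw [lin_smul_left, radd, e5, e6]; simp
  · exact div_ne_zero (by exact_mod_cast hK) (pow_ne_zero _ hΔ0)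
  · rw [ladd, radd, radd, e1, e2, e3, e4]; ring
  · rw [ladd, radd, radd, e1, e2, e3, e4]; ring
  · rw [lin_smul_left, e5, mul_zero]
  · rw [ladd, e1, e3]; simpa using hΔ0
  · rw [lin_smul_left, e5, mul_zero]
  · rw [ladd, e1, e3]; simpa using hΔ0
  · intro p hp
    rw [lin_smul_left] at hp
    have hp0 : lin N p = 0 := (mul_eq_zero.mp hp).resolve_left ht0
    have hpe : p = (lin (B ⨯₃ N) p / Δ) • A + (lin (N ⨯₃ A) p / Δ) • B := by
      have := cramer p
      rw [hp0, zero_smul, add_zero] at this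
      rw [div_eq_inv_mul, div_eq_inv_mul, mul_smul, mul_smul, ← smul_add, ← this, smul_smul,
        inv_mul_cancel₀ hΔ0, one_smul]
    conv_lhs => rw [hpe]
    rw [hsq, ladd, ladd]
    field_simp

end bitangent

section defect

/-- The complex number whose vanishing characterizes the binary quartics
`c₄ x⁴ + c₃ x³ y + c₂ x² y² + c₁ x y³ + c₀ y⁴`, `c₄ ≠ 0`, that are multiples of squares. -/
def sqDefect (c₄ c₃ c₂ c₁ c₀ : ℝ) : ℂ :=
  ⟨3 * c₃ ^ 4 - 16 * c₄ * c₂ * c₃ ^ 2 + 16 * c₄ ^ 2 * c₂ ^ 2 + 16 * c₄ ^ 2 * c₃ * c₁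
      - 64 * c₄ ^ 3 * c₀,
    c₄ * (c₃ ^ 3 - 4 * c₄ * c₃ * c₂ + 8 * c₄ ^ 2 * c₁)⟩

lemma exists_square_of_sqDefect_eq_zero {c₄ c₃ c₂ c₁ c₀ : ℝ} (hc : c₄ ≠ 0)
    (h : sqDefect c₄ c₃ c₂ c₁ c₀ = 0) :
    ∃ u v : ℝ, c₃ = c₄ * (2 * u) ∧ c₂ = c₄ * (u ^ 2 + 2 * v) ∧ c₁ = c₄ * (2 * u * v) ∧
      c₀ = c₄ * v ^ 2 := by
  have hre := congrArg Complex.re h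
  have him := congrArg Complex.im h
  simp only [sqDefect, Complex.zero_re, Complex.zero_im] at hre him
  have hQ := (mul_eq_zero.mp him).resolve_left hc
  refine ⟨c₃ / (2 * c₄), (4 * c₄ * c₂ - c₃ ^ 2) / (8 * c₄ ^ 2), ?_, ?_, ?_, ?_⟩
  · field_simp
  · field_simp; ring
  · field_simp; linear_combination hQ
  · field_simp; linear_combination 2 * c₃ * hQ - hre

/-- The defect of the restriction of a quartic form to the plane spanned by `a` and `b`. -/
def planeDefect (C : Fin 3 → Fin 3 → Fin 3 → Fin 3 → ℝ) (a b : Fin 3 → ℝ) : ℂ :=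
  sqDefect (quadForm C a a a a) (4 * quadForm C a a a b) (6 * quadForm C a a b b)
    (4 * quadForm C a b b b) (quadForm C b b b b)

lemma exists_isSquareOn {C : Fin 3 → Fin 3 → Fin 3 → Fin 3 → ℝ} {a b : Fin 3 → ℝ}
    (hc : quadForm C a a a a ≠ 0) (h : planeDefect C a b = 0) :
    ∃ u v : ℝ, IsSquareOn C a b (quadForm C a a a a) u v := by
  obtain ⟨u, v, h3, h2, h1, h0⟩ := exists_square_of_sqDefect_eq_zero hc h
  exact ⟨u, v, rfl, h3, h2, h1, h0⟩

open Matrix in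
lemma quadForm_single_eq_zero_of_basis {C : Fin 3 → Fin 3 → Fin 3 → Fin 3 → ℂ}
    {a b c p : Fin 3 → ℂ} (hdet : lin (a ⨯₃ b) c ≠ 0)
    (ha : quadForm C a p p p = 0) (hb : quadForm C b p p p = 0) (hc : quadForm C c p p p = 0)
    (i : Fin 3) : quadForm C (Pi.single i 1) p p p = 0 := by
  have key : ∀ x : Fin 3 → ℂ, quadForm C x p p p =
      ∑ i, x i * quadForm C (Pi.single i 1) p p p := by
    intro x
    have hs : ∀ i, quadForm C (Pi.single i 1) p p p =
        ∑ j, ∑ k, ∑ l, C i j k l * p j * p k * p l := by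
      intro i
      rw [quadForm, Finset.sum_eq_single i]
      · simp
      · intro j _ hj
        simp [hj]
      · simp
    simp only [hs]
    simp only [Finset.mul_sum, quadForm]
    refine Finset.sum_congr rfl fun i _ => Finset.sum_congr rfl fun j _ =>
      Finset.sum_congr rfl fun k _ => Finset.sum_congr rfl fun l _ => by ring
  rw [key, Fin.sum_univ_three] at ha hb hc
  refine (mul_eq_zero.mp ?_).resolve_left hdet
  simp only [lin, Fin.sum_univ_three, cross_apply, Matrix.cons_val]
  fin_cases i <;> simp only [Fin.zero_eta, Fin.mk_one, Fin.reduceFinMk]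
  · linear_combination (b 1 * c 2 - b 2 * c 1) * ha + (c 1 * a 2 - c 2 * a 1) * hb
      + (a 1 * b 2 - a 2 * b 1) * hc
  · linear_combination (b 2 * c 0 - b 0 * c 2) * ha + (c 2 * a 0 - c 0 * a 2) * hb
      + (a 2 * b 0 - a 0 * b 2) * hc
  · linear_combination (b 0 * c 1 - b 1 * c 0) * ha + (c 0 * a 1 - c 1 * a 0) * hb
      + (a 0 * b 1 - a 1 * b 0) * hc

open Matrix in
/-- On a smooth quartic, the normal derivative of the defining form does not vanish at the
tangency points of a bitangent: the resultant of the two restrictions is nonzero. -/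
lemma normal_resultant_ne_zero {f : MvPolynomial (Fin 3) ℝ} (hf : f.IsHomogeneous 4)
    (hsm : SmoothQuartic f) {a b N : Fin 3 → ℝ} (hdet : lin (a ⨯₃ b) N ≠ 0) {K u v : ℝ}
    (H : IsSquareOn (polarArray f) a b K u v) {h₃ h₂ h₁ h₀ r₁ r₀ : ℝ}
    (e3 : h₃ = 4 * quadForm (polarArray f) N a a a)
    (e2 : h₂ = 12 * quadForm (polarArray f) N a a b)
    (e1 : h₁ = 12 * quadForm (polarArray f) N a b b)
    (e0 : h₀ = 4 * quadForm (polarArray f) N b b b)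
    (er1 : r₁ = h₃ * (u ^ 2 - v) - h₂ * u + h₁) (er0 : r₀ = h₃ * (u * v) - h₂ * v + h₀) :
    r₀ ^ 2 - u * r₀ * r₁ + v * r₁ ^ 2 ≠ 0 := by
  intro hres
  obtain ⟨g4, g3, g2, g1, g0⟩ := H
  have hS := (isSymmArray_polarArray f).map_carray
  have hdet' : lin (cvec a ⨯₃ cvec b) (cvec N) ≠ 0 := by
    rw [← cvec_cross, lin_cvec]; exact_mod_cast hdet
  obtain ⟨t, ht, hr⟩ : ∃ t : ℂ, t ^ 2 + u * t + v = 0 ∧ r₁ * t + r₀ = 0 := by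
    obtain ⟨d, hd⟩ := IsAlgClosed.exists_eq_mul_self ((u : ℂ) ^ 2 - 4 * v)
    have hres' : ((r₁ : ℂ) * ((-u + d) / 2) + r₀) * (r₁ * ((-u - d) / 2) + r₀) = 0 := by
      have := congrArg Complex.ofReal hres
      push_cast at this
      linear_combination this + r₁ ^ 2 / 4 * hd
    rcases mul_eq_zero.mp hres' with h | h
    · exact ⟨(-u + d) / 2, by linear_combination -hd / 4, h⟩
    · exact ⟨(-u - d) / 2, by linear_combination -hd / 4, h⟩
  set p := t • cvec a + (1 : ℂ) • cvec b with hp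
  have hp0 : p ≠ 0 := by
    intro h
    apply hdet'
    have : lin (cvec a ⨯₃ cvec b) (cvec N) = lin (cvec a ⨯₃ p) (cvec N) := by
      simp [hp, lin, Fin.sum_univ_three, cross_apply]; ring
    rw [this, h]
    simp [lin]
  have c4 := congrArg Complex.ofReal g4
  have c3 := congrArg Complex.ofReal g3
  have c2 := congrArg Complex.ofReal g2
  have c1 := congrArg Complex.ofReal g1
  have c0 := congrArg Complex.ofReal g0
  have er1' := congrArg Complex.ofReal er1
  have er0' := congrArg Complex.ofReal er0
  have e3' := congrArg Complex.ofReal e3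
  have e2' := congrArg Complex.ofReal e2
  have e1' := congrArg Complex.ofReal e1
  have e0' := congrArg Complex.ofReal e0
  push_cast at c4 c3 c2 c1 c0 er1' er0' e3' e2' e1' e0'
  have hpa : quadForm (carray (polarArray f)) (cvec a) p p p = 0 := by
    rw [hp, quadForm_mixed_expand hS]
    simp only [quadForm_cvec]
    linear_combination t ^ 3 * c4 + 3 / 4 * t ^ 2 * c3 + t / 2 * c2 + c1 / 4
      + (K : ℂ) / 2 * (2 * t + u) * ht
  have hpb : quadForm (carray (polarArray f)) (cvec b) p p p = 0 := by
    have h1 := quadForm_expand hS t 1 (cvec a) (cvec b)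
    rw [← hp] at h1
    have h2 : quadForm (carray (polarArray f)) p p p p =
        t * quadForm (carray (polarArray f)) (cvec a) p p p +
          1 * quadForm (carray (polarArray f)) (cvec b) p p p := by
      rw [← quadForm_add_smul]
    simp only [quadForm_cvec] at h1
    linear_combination -h2 + h1 - t * hpa + t ^ 4 * c4 + t ^ 3 * c3 + t ^ 2 * c2 + t * c1 + c0
      + K * (t ^ 2 + u * t + v) * ht
  have hpN : quadForm (carray (polarArray f)) (cvec N) p p p = 0 := by
    rw [hp, quadForm_mixed_expand hS]
    simp only [quadForm_cvec]
    linear_combination (hr - t * er1' - er0' - e1' * t - e0' - e2' * t ^ 2 - e3' * t ^ 3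
      + (h₃ * (t - u) + h₂) * ht) / 4
  obtain ⟨i, hi⟩ := hsm.exists_quadForm_single_ne_zero hf hp0
  exact hi (quadForm_single_eq_zero_of_basis hdet' hpa hpb hpN i)

end defect

section frame

open Real

variable {u v w : Fin 3 → ℝ}

lemma sqDefect_eq (c₄ c₃ c₂ c₁ c₀ : ℝ) : sqDefect c₄ c₃ c₂ c₁ c₀ =
    ((3 * c₃ ^ 4 - 16 * c₄ * c₂ * c₃ ^ 2 + 16 * c₄ ^ 2 * c₂ ^ 2 + 16 * c₄ ^ 2 * c₃ * c₁
      - 64 * c₄ ^ 3 * c₀ : ℝ) : ℂ) +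
    ((c₄ * (c₃ ^ 3 - 4 * c₄ * c₃ * c₂ + 8 * c₄ ^ 2 * c₁) : ℝ) : ℂ) * Complex.I := by
  rw [sqDefect, Complex.mk_eq_add_mul_I]

lemma hasDerivAt_sqDefect {c₄ c₃ c₂ c₁ c₀ : ℝ → ℝ} {d₄ d₃ d₂ d₁ d₀ x K u v : ℝ}
    (h₄ : HasDerivAt c₄ d₄ x) (h₃ : HasDerivAt c₃ d₃ x) (h₂ : HasDerivAt c₂ d₂ x)
    (h₁ : HasDerivAt c₁ d₁ x) (h₀ : HasDerivAt c₀ d₀ x)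
    (e₄ : c₄ x = K) (e₃ : c₃ x = K * (2 * u)) (e₂ : c₂ x = K * (u ^ 2 + 2 * v))
    (e₁ : c₁ x = K * (2 * u * v)) (e₀ : c₀ x = K * v ^ 2) {R₁ R₀ : ℝ}
    (hR₁ : R₁ = d₄ * (2 * u * v - u ^ 3) + d₃ * (u ^ 2 - v) - u * d₂ + d₁)
    (hR₀ : R₀ = -d₄ * (v * (u ^ 2 - v)) + d₃ * (u * v) - v * d₂ + d₀) :
    HasDerivAt (fun t => sqDefect (c₄ t) (c₃ t) (c₂ t) (c₁ t) (c₀ t))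
      (((-64 * K ^ 3 * R₀ + 32 * K ^ 3 * u * R₁ : ℝ) : ℂ) + ((8 * K ^ 3 * R₁ : ℝ) : ℂ) * Complex.I)
      x := by
  simp only [sqDefect_eq]
  have hD := (((((h₃.pow 4).const_mul 3).sub (((h₄.const_mul 16).mul h₂).mul (h₃.pow 2))).add
    (((h₄.pow 2).const_mul 16).mul (h₂.pow 2))).add
    ((((h₄.pow 2).const_mul 16).mul h₃).mul h₁)).sub (((h₄.pow 3).const_mul 64).mul h₀)
  have hQ := h₄.mul (((h₃.pow 3).sub (((h₄.const_mul 4).mul h₃).mul h₂)).add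
    (((h₄.pow 2).const_mul 8).mul h₁))
  refine HasDerivAt.add (HasDerivAt.ofReal_comp (hD.congr_deriv ?_))
    ((HasDerivAt.ofReal_comp (hQ.congr_deriv ?_)).mul_const Complex.I)
  · simp [e₄, e₃, e₂, e₁, e₀, hR₁, hR₀]; ring
  · simp [e₄, e₃, e₂, e₁, hR₁]; ring

lemma HasDerivAt.quadForm {C : Fin 3 → Fin 3 → Fin 3 → Fin 3 → ℝ} {a b c d : ℝ → Fin 3 → ℝ}
    {a' b' c' d' : Fin 3 → ℝ} {x : ℝ} (ha : HasDerivAt a a' x) (hb : HasDerivAt b b' x)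
    (hc : HasDerivAt c c' x) (hd : HasDerivAt d d' x) :
    HasDerivAt (fun t => quadForm C (a t) (b t) (c t) (d t))
      (quadForm C a' (b x) (c x) (d x) + quadForm C (a x) b' (c x) (d x) +
        quadForm C (a x) (b x) c' (d x) + quadForm C (a x) (b x) (c x) d') x := by
  rw [hasDerivAt_pi] at ha hb hc hd
  unfold _root_.quadForm
  simp only [← Finset.sum_add_distrib]
  refine HasDerivAt.fun_sum fun i _ => HasDerivAt.fun_sum fun j _ => HasDerivAt.fun_sum fun k _ =>
    HasDerivAt.fun_sum fun l _ => ?_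
  refine (((((ha i).const_mul (C i j k l)).mul (hb j)).mul (hc k)).mul (hd l)).congr_deriv ?_
  simp only [Pi.mul_apply]
  ring

/-- The rotating direction in the plane spanned by `u` and `v`. -/
def frameDir (u v : Fin 3 → ℝ) (θ : ℝ) : Fin 3 → ℝ := cos θ • u + sin θ • v

/-- The derivative of `frameDir`. -/
def frameDir' (u v : Fin 3 → ℝ) (θ : ℝ) : Fin 3 → ℝ := (-sin θ) • u + cos θ • v

/-- The second point of the moving line. -/
def framePt (u v w : Fin 3 → ℝ) (φ θ : ℝ) : Fin 3 → ℝ := cos φ • w + sin φ • frameDir' u v θ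

/-- The normal direction of the moving line. -/
def frameNormal (u v w : Fin 3 → ℝ) (φ θ : ℝ) : Fin 3 → ℝ :=
  (-sin φ) • w + cos φ • frameDir' u v θ

lemma frameDir'_eq (φ θ : ℝ) :
    frameDir' u v θ = sin φ • framePt u v w φ θ + cos φ • frameNormal u v w φ θ := by
  funext i
  simp only [framePt, frameNormal, Pi.add_apply, Pi.smul_apply, smul_eq_mul]
  linear_combination -(frameDir' u v θ i) * sin_sq_add_cos_sq φ

lemma hasDerivAt_frameDir (θ : ℝ) : HasDerivAt (frameDir u v) (frameDir' u v θ) θ :=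
  ((hasDerivAt_cos θ).smul_const u).add ((hasDerivAt_sin θ).smul_const v)

lemma hasDerivAt_frameDir' (θ : ℝ) : HasDerivAt (frameDir' u v) (-frameDir u v θ) θ := by
  refine (((hasDerivAt_sin θ).neg.smul_const u).add
    ((hasDerivAt_cos θ).smul_const v)).congr_deriv ?_
  simp [frameDir]; abel

open Matrix in
lemma lin_cross_frame (φ θ : ℝ) :
    lin (frameDir u v θ ⨯₃ framePt u v w φ θ) (frameNormal u v w φ θ) = -lin (u ⨯₃ v) w := by
  have h1 := sin_sq_add_cos_sq φ
  have h2 := sin_sq_add_cos_sq θ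
  have : lin (frameDir u v θ ⨯₃ framePt u v w φ θ) (frameNormal u v w φ θ) =
      -((sin φ ^ 2 + cos φ ^ 2) * (sin θ ^ 2 + cos θ ^ 2) * lin (u ⨯₃ v) w) := by
    simp only [lin, Fin.sum_univ_three, cross_apply, frameDir, framePt, frameNormal, frameDir',
      Pi.add_apply, Pi.smul_apply, smul_eq_mul, Matrix.cons_val]
    ring
  rw [this, h1, h2]; ring

open Matrix in
lemma cross_frame (φ θ : ℝ) : frameDir u v θ ⨯₃ framePt u v w φ θ =
    (cos φ * cos θ) • (u ⨯₃ w) + (cos φ * sin θ) • (v ⨯₃ w) + sin φ • (u ⨯₃ v) := by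
  have h2 := sin_sq_add_cos_sq θ
  funext i
  fin_cases i <;> simp [cross_apply, frameDir, framePt, frameDir']
  · linear_combination sin φ * (u 1 * v 2 - u 2 * v 1) * h2
  · linear_combination sin φ * (u 2 * v 0 - u 0 * v 2) * h2
  · linear_combination sin φ * (u 0 * v 1 - u 1 * v 0) * h2

/-- The defect on the line spanned by the moving frame, as a function on the strip. -/
def stripDefect (C : Fin 3 → Fin 3 → Fin 3 → Fin 3 → ℝ) (u v w : Fin 3 → ℝ) (ζ : ℂ) : ℂ :=
  planeDefect C (frameDir u v ζ.im) (framePt u v w ζ.re ζ.im)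

lemma Differentiable.sqDefect {E : Type*} [NormedAddCommGroup E] [NormedSpace ℝ E]
    {c₄ c₃ c₂ c₁ c₀ : E → ℝ} (h₄ : Differentiable ℝ c₄) (h₃ : Differentiable ℝ c₃)
    (h₂ : Differentiable ℝ c₂) (h₁ : Differentiable ℝ c₁) (h₀ : Differentiable ℝ c₀) :
    Differentiable ℝ fun x => sqDefect (c₄ x) (c₃ x) (c₂ x) (c₁ x) (c₀ x) := by
  have hof : Differentiable ℝ Complex.ofReal := Complex.ofRealCLM.differentiable
  simp only [sqDefect_eq]
  refine Differentiable.fun_add (hof.comp ?_) (Differentiable.mul_const (hof.comp ?_) _) <;>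
    fun_prop

lemma Differentiable.quadForm {E : Type*} [NormedAddCommGroup E] [NormedSpace ℝ E]
    {C : Fin 3 → Fin 3 → Fin 3 → Fin 3 → ℝ} {a b c d : E → Fin 3 → ℝ} (ha : Differentiable ℝ a)
    (hb : Differentiable ℝ b) (hc : Differentiable ℝ c) (hd : Differentiable ℝ d) :
    Differentiable ℝ fun x => quadForm C (a x) (b x) (c x) (d x) := by
  rw [differentiable_pi] at ha hb hc hd
  unfold _root_.quadForm
  refine Differentiable.fun_sum fun i _ => Differentiable.fun_sum fun j _ =>
    Differentiable.fun_sum fun k _ => Differentiable.fun_sum fun l _ => ?_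
  exact ((((ha i).const_mul _).mul (hb j)).mul (hc k)).mul (hd l)

lemma differentiable_stripDefect (C : Fin 3 → Fin 3 → Fin 3 → Fin 3 → ℝ) :
    Differentiable ℝ (stripDefect C u v w) := by
  have hre : Differentiable ℝ Complex.re := Complex.reCLM.differentiable
  have him : Differentiable ℝ Complex.im := Complex.imCLM.differentiable
  have hd : Differentiable ℝ fun ζ : ℂ => frameDir u v ζ.im :=
    ((him.cos).smul_const u).add ((him.sin).smul_const v)
  have hd' : Differentiable ℝ fun ζ : ℂ => frameDir' u v ζ.im :=
    ((him.sin).neg.smul_const u).add ((him.cos).smul_const v)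
  have hp : Differentiable ℝ fun ζ : ℂ => framePt u v w ζ.re ζ.im :=
    ((hre.cos).smul_const w).add ((hre.sin).smul hd')
  exact (Differentiable.quadForm hd hd hd hd).sqDefect
    ((Differentiable.quadForm hd hd hd hp).const_mul 4)
    ((Differentiable.quadForm hd hd hp hp).const_mul 6)
    ((Differentiable.quadForm hd hp hp hp).const_mul 4) (Differentiable.quadForm hp hp hp hp)

end frame

section transversality

open Real

lemma hasDerivAt_planeDefect {C : Fin 3 → Fin 3 → Fin 3 → Fin 3 → ℝ} (hC : IsSymmArray C)
    {a b : ℝ → Fin 3 → ℝ} {a' b' : Fin 3 → ℝ} {x K u v : ℝ} (ha : HasDerivAt a a' x)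
    (hb : HasDerivAt b b' x) (H : IsSquareOn C (a x) (b x) K u v)
    {d₄ d₃ d₂ d₁ d₀ R₁ R₀ : ℝ}
    (h₄ : d₄ = 4 * quadForm C a' (a x) (a x) (a x))
    (h₃ : d₃ = 12 * quadForm C a' (a x) (a x) (b x) + 4 * quadForm C b' (a x) (a x) (a x))
    (h₂ : d₂ = 12 * quadForm C a' (a x) (b x) (b x) + 12 * quadForm C b' (a x) (a x) (b x))
    (h₁ : d₁ = 4 * quadForm C a' (b x) (b x) (b x) + 12 * quadForm C b' (a x) (b x) (b x))
    (h₀ : d₀ = 4 * quadForm C b' (b x) (b x) (b x))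
    (hR₁ : R₁ = d₄ * (2 * u * v - u ^ 3) + d₃ * (u ^ 2 - v) - u * d₂ + d₁)
    (hR₀ : R₀ = -d₄ * (v * (u ^ 2 - v)) + d₃ * (u * v) - v * d₂ + d₀) :
    HasDerivAt (fun t => planeDefect C (a t) (b t))
      (((-64 * K ^ 3 * R₀ + 32 * K ^ 3 * u * R₁ : ℝ) : ℂ) + ((8 * K ^ 3 * R₁ : ℝ) : ℂ) * Complex.I)
      x := by
  have s1 := fun p q r s => quadForm_swap₁ hC p q r s
  have s2 := fun p q r s => quadForm_swap₂ hC p q r s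
  have s3 := fun p q r s => quadForm_swap₃ hC p q r s
  refine hasDerivAt_sqDefect ((ha.quadForm ha ha ha).congr_deriv ?_)
    (((ha.quadForm ha ha hb).const_mul 4).congr_deriv ?_)
    (((ha.quadForm ha hb hb).const_mul 6).congr_deriv ?_)
    (((ha.quadForm hb hb hb).const_mul 4).congr_deriv ?_)
    ((hb.quadForm hb hb hb).congr_deriv ?_) H.coeff₄ H.coeff₃ H.coeff₂ H.coeff₁ H.coeff₀ hR₁ hR₀
  · rw [h₄, s1 (a x) a', s2 (a x) (a x) a', s1 (a x) a', s3 (a x) (a x) (a x) a',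
      s2 (a x) (a x) a', s1 (a x) a']
    ring
  · rw [h₃, s1 (a x) a', s2 (a x) (a x) a', s1 (a x) a', s3 (a x) (a x) (a x) b',
      s2 (a x) (a x) b', s1 (a x) b']
    ring
  · rw [h₂, s1 (a x) a', s2 (a x) (a x) b', s1 (a x) b', s3 (a x) (a x) (b x) b',
      s2 (a x) (a x) b', s1 (a x) b']
    ring
  · rw [h₁, s1 (a x) b', s2 (a x) (b x) b', s1 (a x) b', s3 (a x) (b x) (b x) b',
      s2 (a x) (b x) b', s1 (a x) b']
    ring
  · rw [h₀, s1 (b x) b', s2 (b x) (b x) b', s1 (b x) b', s3 (b x) (b x) (b x) b',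
      s2 (b x) (b x) b', s1 (b x) b']
    ring

/-- The linear relations expressing that the defect is stationary along an infinitesimal motion
`a' = α N + γ b`, `b' = β N - γ a` of the plane force the motion to be trivial. -/
lemma eq_zero_of_stationary {r₁ r₀ u v α β : ℝ} (hres : r₀ ^ 2 - u * r₀ * r₁ + v * r₁ ^ 2 ≠ 0)
    (h₁ : α * r₀ + β * r₁ - u * α * r₁ = 0) (h₀ : β * r₀ - v * α * r₁ = 0) :
    α = 0 ∧ β = 0 :=
  ⟨(mul_eq_zero.mp (by linear_combination r₀ * h₁ - r₁ * h₀ :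
      α * (r₀ ^ 2 - u * r₀ * r₁ + v * r₁ ^ 2) = 0)).resolve_right hres,
    (mul_eq_zero.mp (by linear_combination v * r₁ * h₁ + (r₀ - u * r₁) * h₀ :
      β * (r₀ ^ 2 - u * r₀ * r₁ + v * r₁ ^ 2) = 0)).resolve_right hres⟩

open Matrix in
lemma stationary_motion_eq_zero {f : MvPolynomial (Fin 3) ℝ} (hf : f.IsHomogeneous 4)
    (hsm : SmoothQuartic f) {a b : ℝ → Fin 3 → ℝ} {N : Fin 3 → ℝ} {x K u v α β γ : ℝ} (hK : K ≠ 0)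
    (hdet : lin (a x ⨯₃ b x) N ≠ 0)
    (ha : HasDerivAt a (α • N + γ • b x) x) (hb : HasDerivAt b (β • N + (-γ) • a x) x)
    (H : IsSquareOn (polarArray f) (a x) (b x) K u v)
    (h : HasDerivAt (fun t => planeDefect (polarArray f) (a t) (b t)) 0 x) :
    α = 0 ∧ β = 0 := by
  have hC := isSymmArray_polarArray f
  have hder := hasDerivAt_planeDefect hC ha hb H rfl rfl rfl rfl rfl rfl rfl
  have key := hder.unique h
  have hres := normal_resultant_ne_zero hf hsm hdet H rfl rfl rfl rfl rfl rfl
  obtain ⟨g4, g3, g2, g1, g0⟩ := H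
  have s1 := fun p q r s => quadForm_swap₁ hC p q r s
  have s2 := fun p q r s => quadForm_swap₂ hC p q r s
  have s3 := fun p q r s => quadForm_swap₃ hC p q r s
  generalize hA : a x = A at *
  generalize hB : b x = B at *
  have q1 : quadForm (polarArray f) B A A A = quadForm (polarArray f) A A A B := by
    rw [s1 B, s2 A B, s3 A A B]
  have q2 : quadForm (polarArray f) B A A B = quadForm (polarArray f) A A B B := by
    rw [s1 B, s2 A B]
  have q3 : quadForm (polarArray f) B A B B = quadForm (polarArray f) A B B B := s1 _ _ _ _
  simp only [quadForm_add_smul, q1, q2, q3] at key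
  have him := congrArg Complex.im key
  have hre := congrArg Complex.re key
  simp only [Complex.add_re, Complex.add_im, Complex.ofReal_re, Complex.ofReal_im,
    Complex.re_ofReal_mul, Complex.im_ofReal_mul, Complex.I_re, Complex.I_im, Complex.zero_re,
    Complex.zero_im, mul_zero, mul_one, add_zero, zero_add] at him hre
  have h1 := (mul_eq_zero.mp him).resolve_left (by positivity)
  rw [h1, mul_zero, add_zero] at hre
  have h0 := (mul_eq_zero.mp hre).resolve_left (by simpa using hK)
  refine eq_zero_of_stationary hres ?_ ?_
  · linear_combination h1
      - γ * ((2 * u * v - u ^ 3) * g3 + (u ^ 2 - v) * (2 * g2 - 4 * g4) - u * (3 * g1 - 3 * g3)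
        + 4 * g0 - 2 * g2)
  · linear_combination h0
      - γ * (-(v * (u ^ 2 - v)) * g3 + u * v * (2 * g2 - 4 * g4) - v * (3 * g1 - 3 * g3) - g1)

open Matrix in
lemma exists_injective_hasFDerivAt_stripDefect {f : MvPolynomial (Fin 3) ℝ}
    (hf : f.IsHomogeneous 4) (hsm : SmoothQuartic f) {u v w : Fin 3 → ℝ}
    (huvw : lin (u ⨯₃ v) w ≠ 0) {ζ : ℂ} (hζ : |ζ.re| < π / 2)
    (hne : quadForm (polarArray f) (frameDir u v ζ.im) (frameDir u v ζ.im) (frameDir u v ζ.im)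
      (frameDir u v ζ.im) ≠ 0)
    (h0 : stripDefect (polarArray f) u v w ζ = 0) :
    ∃ A : ℂ →L[ℝ] ℂ, Function.Injective A ∧
      HasFDerivAt (stripDefect (polarArray f) u v w) A ζ := by
  refine ⟨_, ?_, (differentiable_stripDefect (polarArray f) ζ).hasFDerivAt⟩
  rw [injective_iff_map_eq_zero]
  intro η hη
  obtain ⟨μ, ν, H⟩ := exists_isSquareOn hne h0
  have hline : HasDerivAt (fun t : ℝ => ζ + t • η) η 0 := by
    simpa using ((hasDerivAt_id (0 : ℝ)).smul_const η).const_add ζ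
  have hre : HasDerivAt (fun t : ℝ => (ζ + t • η).re) η.re 0 := by
    simpa using ((hasDerivAt_id (0 : ℝ)).mul_const η.re).const_add ζ.re
  have him : HasDerivAt (fun t : ℝ => (ζ + t • η).im) η.im 0 := by
    simpa using ((hasDerivAt_id (0 : ℝ)).mul_const η.im).const_add ζ.im
  have z0 : ζ + (0 : ℝ) • η = ζ := by simp
  have hder : HasDerivAt (fun t : ℝ => stripDefect (polarArray f) u v w (ζ + t • η)) 0 0 := by
    have h1 := (differentiable_stripDefect (u := u) (v := v) (w := w) (polarArray f) ζ).hasFDerivAt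
    rw [← z0] at h1
    have := h1.comp_hasDerivAt (0 : ℝ) hline
    rw [z0, hη] at this
    exact this
  have hfd := (hasDerivAt_frameDir (u := u) (v := v) (ζ + (0 : ℝ) • η).im).scomp (0 : ℝ) him
  have hfd' := (hasDerivAt_frameDir' (u := u) (v := v) (ζ + (0 : ℝ) • η).im).scomp (0 : ℝ) him
  have hcos := (hasDerivAt_cos (ζ + (0 : ℝ) • η).re).comp (0 : ℝ) hre
  have hsin := (hasDerivAt_sin (ζ + (0 : ℝ) • η).re).comp (0 : ℝ) hre
  have hpt := (hcos.smul_const w).add (hsin.smul hfd')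
  have hc : 0 < cos ζ.re := cos_pos_of_mem_Ioo (abs_lt.mp hζ)
  have := stationary_motion_eq_zero hf hsm (x := 0)
    (a := fun t : ℝ => frameDir u v (ζ + t • η).im)
    (b := fun t : ℝ => framePt u v w (ζ + t • η).re (ζ + t • η).im)
    (N := frameNormal u v w ζ.re ζ.im) (α := η.im * cos ζ.re) (β := η.re)
    (γ := η.im * sin ζ.re) (K := _) (u := μ) (v := ν) hne
    (by simp only [z0]; rw [lin_cross_frame]; simpa using huvw)
    (hfd.congr_deriv (by
      simp only [z0]
      rw [frameDir'_eq (w := w) ζ.re, smul_add, smul_smul, smul_smul, add_comm]))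
    (hpt.congr_deriv (by
      simp only [z0, frameNormal, Function.comp]
      module))
    (by simp only [z0]; exact H) hder
  obtain ⟨h1, h2⟩ := this
  exact Complex.ext h2 ((mul_eq_zero.mp h1).resolve_right hc.ne')

end transversality

section boundary

open Real

lemma sqDefect_mul_eq {K α₂ α₁ α₀ β₂ β₁ β₀ y z P S R : ℝ} (hα : 4 * α₂ * α₀ = α₁ ^ 2 + 4 * y ^ 2)
    (hβ : 4 * β₂ * β₀ = β₁ ^ 2 + 4 * z ^ 2) (hα₂ : α₂ ≠ 0) (hβ₂ : β₂ ≠ 0)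
    (hP : P = y * β₂ - z * α₂) (hS : S = y * β₂ + z * α₂) (hR : R = β₁ * α₂ - α₁ * β₂) :
    sqDefect (K * (α₂ * β₂)) (K * (α₂ * β₁ + α₁ * β₂)) (K * (α₂ * β₀ + α₁ * β₁ + α₀ * β₂))
      (K * (α₁ * β₀ + α₀ * β₁)) (K * (α₀ * β₀)) =
    ⟨4 * K ^ 4 * (4 * (P * S) ^ 2 - R ^ 2 * (S ^ 2 + P ^ 2)),
      4 * K ^ 4 * (α₂ * β₂) * (R * (P * S))⟩ := by
  have h1 : α₀ = (α₁ ^ 2 + 4 * y ^ 2) / (4 * α₂) := by field_simp; linear_combination hα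
  have h2 : β₀ = (β₁ ^ 2 + 4 * z ^ 2) / (4 * β₂) := by field_simp; linear_combination hβ
  subst h1 h2 hP hS hR
  refine Complex.ext ?_ ?_ <;> simp only [sqDefect] <;> field_simp <;> ring

lemma HasWinding.of_parts {P S R M : ℝ → ℝ} {k : ℤ} {c : ℝ}
    (H : HasWinding (fun θ => ((R θ / 2 : ℝ) : ℂ) + (P θ : ℂ) * Complex.I) k) (hS : Continuous S)
    (hSper : ∀ θ, S (θ + 2 * π) = S θ) (hSpos : ∀ θ, 0 < S θ) (hM : ∀ θ, 0 < M θ) (hc : 0 < c)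
    {G : ℝ → ℂ} (hG : Continuous G) (hGper : ∀ θ, G (θ + 2 * π) = G θ)
    (hre : ∀ θ, (G θ).re = c * (4 * (P θ * S θ) ^ 2 - R θ ^ 2 * (S θ ^ 2 + P θ ^ 2)))
    (him : ∀ θ, (G θ).im = c * M θ * (R θ * (P θ * S θ))) :
    HasWinding G (-(2 * k)) := by
  have hR : Continuous R := by
    have := Complex.continuous_re.comp H.continuous
    exact (this.const_mul 2).congr fun θ => by simp; ring
  have hP : Continuous P := by
    have := Complex.continuous_im.comp H.continuous
    exact this.congr fun θ => by simp
  have hRper : ∀ θ, R (θ + 2 * π) = R θ := fun θ => by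
    have := congrArg Complex.re (H.periodic θ)
    simp only [Complex.add_re, Complex.ofReal_re, Complex.re_ofReal_mul, Complex.I_re] at this
    linarith
  have hPper : ∀ θ, P (θ + 2 * π) = P θ := fun θ => by
    have := congrArg Complex.im (H.periodic θ)
    simp only [Complex.add_im, Complex.ofReal_im, Complex.im_ofReal_mul, Complex.I_im] at this
    linarith
  have hsq : ∀ θ, √(S θ ^ 2 + P θ ^ 2) ^ 2 = S θ ^ 2 + P θ ^ 2 := fun θ => sq_sqrt (by positivity)
  have hsqpos : ∀ θ, 0 < √(S θ ^ 2 + P θ ^ 2) := fun θ => sqrt_pos.mpr (by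
    have := hSpos θ; positivity)
  have h1 : HasWinding (fun θ => ((2 * (P θ * S θ) : ℝ) : ℂ) +
      ((√(S θ ^ 2 + P θ ^ 2) * R θ : ℝ) : ℂ) * Complex.I) (-k) := by
    have := (HasWinding.const Complex.I_ne_zero).mul H.conj
    rw [zero_add] at this
    refine this.of_re_pos (by fun_prop) (fun θ => by simp only [hSper, hPper, hRper]) fun θ => ?_
    have h0 := H.ne_zero θ
    have h0' : 0 < P θ ^ 2 + R θ ^ 2 := by
      by_contra hn
      have hPz : P θ = 0 := by nlinarith [sq_nonneg (P θ), sq_nonneg (R θ)]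
      have hRz : R θ = 0 := by nlinarith [sq_nonneg (P θ), sq_nonneg (R θ)]
      simp [hPz, hRz] at h0
    have : ((((2 * (P θ * S θ) : ℝ) : ℂ) + ((√(S θ ^ 2 + P θ ^ 2) * R θ : ℝ) : ℂ) * Complex.I) *
        (starRingEnd ℂ) (Complex.I * (starRingEnd ℂ)
          (((R θ / 2 : ℝ) : ℂ) + (P θ : ℂ) * Complex.I))).re =
        2 * S θ * P θ ^ 2 + √(S θ ^ 2 + P θ ^ 2) / 2 * R θ ^ 2 := by
      simp; ring
    rw [this]
    rcases (sq_nonneg (P θ)).lt_or_eq with h | h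
    · have := hSpos θ
      have := hsqpos θ
      positivity
    · have := hSpos θ
      have := hsqpos θ
      have : 0 < R θ ^ 2 := by linarith
      positivity
  have h2 := h1.mul h1
  rw [show -k + -k = -(2 * k) by ring] at h2
  refine h2.of_re_pos hG hGper fun θ => ?_
  have hn := h2.ne_zero θ
  set κ := √(S θ ^ 2 + P θ ^ 2) with hκ
  have e : (((2 * (P θ * S θ) : ℝ) : ℂ) + ((κ * R θ : ℝ) : ℂ) * Complex.I) *
      (((2 * (P θ * S θ) : ℝ) : ℂ) + ((κ * R θ : ℝ) : ℂ) * Complex.I) =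
      ⟨4 * (P θ * S θ) ^ 2 - R θ ^ 2 * (S θ ^ 2 + P θ ^ 2), 4 * κ * (R θ * (P θ * S θ))⟩ := by
    refine Complex.ext ?_ ?_
    · simp; linear_combination -R θ ^ 2 * hsq θ
    · simp; ring
  rw [e] at hn ⊢
  set A := 4 * (P θ * S θ) ^ 2 - R θ ^ 2 * (S θ ^ 2 + P θ ^ 2) with hA
  set B := R θ * (P θ * S θ) with hB
  have e2 : (G θ * (starRingEnd ℂ) (⟨A, 4 * κ * B⟩ : ℂ)).re =
      c * A ^ 2 + 4 * c * M θ * κ * B ^ 2 := by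
    simp only [Complex.mul_re, Complex.conj_re, Complex.conj_im, hre, him]; ring
  rw [e2]
  have k0 := hsqpos θ
  have m0 := hM θ
  rcases eq_or_ne A 0 with h | h
  · have hB0 : B ≠ 0 := by
      rintro hB0
      exact hn (Complex.ext h (by simp [hB0]))
    positivity
  · positivity

lemma hasWinding_cos_sub_mul_sin {τ : ℂ} (hτ : 0 < τ.im) :
    HasWinding (fun θ => (cos θ : ℂ) - τ * (sin θ : ℂ)) (-1) := by
  have h0 : (1 - Complex.I * τ) ≠ 0 := by
    intro h
    have := congrArg Complex.re h
    simp at this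
    linarith
  have := (HasWinding.const h0).mul HasWinding.exp_mul_I.conj
  rw [zero_add] at this
  refine this.of_re_pos (by fun_prop) (fun θ => by simp) fun θ => ?_
  have e : Complex.exp (θ * Complex.I) = ⟨cos θ, sin θ⟩ := by
    rw [Complex.exp_mul_I]
    refine Complex.ext ?_ ?_ <;> simp [← Complex.ofReal_cos, ← Complex.ofReal_sin]
  rw [e]
  have hsc := sin_sq_add_cos_sq θ
  have hx : (((cos θ : ℂ) - τ * (sin θ : ℂ)) * (starRingEnd ℂ) ((1 - Complex.I * τ) *
      (starRingEnd ℂ) (⟨cos θ, sin θ⟩ : ℂ))).re =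
      τ.im + (cos θ - τ.re * sin θ) ^ 2 + (τ.im * sin θ) ^ 2 := by
    simp only [Complex.mul_re, Complex.mul_im, Complex.sub_re, Complex.sub_im, Complex.ofReal_re,
      Complex.ofReal_im, Complex.conj_re, Complex.conj_im, Complex.I_re, Complex.I_im,
      Complex.one_re, Complex.one_im]
    linear_combination τ.im * hsc
  rw [hx]
  positivity

/-- A real binary quartic without real zeros is a product of two definite quadratic forms. -/
lemma exists_definite_factorization {c₄ c₃ c₂ c₁ c₀ : ℝ} (hc : c₄ ≠ 0)
    (h : ∀ t : ℝ, c₄ * t ^ 4 + c₃ * t ^ 3 + c₂ * t ^ 2 + c₁ * t + c₀ ≠ 0) :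
    ∃ τ σ : ℂ, 0 < τ.im ∧ 0 < σ.im ∧
      c₃ = c₄ * (-2 * τ.re - 2 * σ.re) ∧
      c₂ = c₄ * (Complex.normSq τ + 4 * τ.re * σ.re + Complex.normSq σ) ∧
      c₁ = c₄ * (-2 * τ.re * Complex.normSq σ - 2 * σ.re * Complex.normSq τ) ∧
      c₀ = c₄ * (Complex.normSq τ * Complex.normSq σ) := by
  have step : ∀ p : Polynomial ℝ, p.degree ≠ 0 → (∀ t, p.eval t ≠ 0) →
      ∃ (τ : ℂ) (q : Polynomial ℝ), 0 < τ.im ∧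
        p = (.X ^ 2 - .C (2 * τ.re) * .X + .C (Complex.normSq τ)) * q := by
    intro p hp hp0
    obtain ⟨z, hz⟩ := IsAlgClosed.exists_aeval_eq_zero ℂ p hp
    have him : z.im ≠ 0 := by
      intro hi
      have hzr : z = (z.re : ℂ) := Complex.ext rfl (by simpa using hi)
      rw [hzr, ← Complex.coe_algebraMap, Polynomial.aeval_algebraMap_apply] at hz
      exact hp0 z.re (by simpa using hz)
    obtain ⟨q, hq⟩ := Polynomial.quadratic_dvd_of_aeval_eq_zero_im_ne_zero p hz him
    rw [← Complex.normSq_eq_norm_sq] at hq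
    rcases him.lt_or_gt with hi | hi
    · exact ⟨(starRingEnd ℂ) z, q, by simpa using hi, by
        rw [Complex.normSq_conj, Complex.conj_re]; exact hq⟩
    · exact ⟨z, q, hi, hq⟩
  set p : Polynomial ℝ := .C c₄ * .X ^ 4 + .C c₃ * .X ^ 3 + .C c₂ * .X ^ 2 + .C c₁ * .X + .C c₀
    with hp
  have hdeg : p.natDegree = 4 := by rw [hp]; compute_degree!
  have hmon : ∀ τ : ℂ, ((.X ^ 2 - .C (2 * τ.re) * .X + .C (Complex.normSq τ) :
      Polynomial ℝ)).Monic := by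
    intro τ; monicity!
  have hmdeg : ∀ τ : ℂ, ((.X ^ 2 - .C (2 * τ.re) * .X + .C (Complex.normSq τ) :
      Polynomial ℝ)).natDegree = 2 := by
    intro τ; compute_degree!
  obtain ⟨τ, q, hτ, hq⟩ := step p
    (fun h0 => by simp [Polynomial.natDegree_eq_of_degree_eq_some h0] at hdeg)
    (fun t => by simpa [hp] using h t)
  have hqdeg : q.natDegree = 2 := by
    have h1 := (hmon τ).natDegree_mul' (q := q) (by
      rintro rfl
      simp [hq] at hdeg)
    rw [← hq, hdeg, hmdeg] at h1
    omega
  obtain ⟨σ, r, hσ, hr⟩ := step q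
    (fun h0 => by simp [Polynomial.natDegree_eq_of_degree_eq_some h0] at hqdeg)
    (fun t ht => by
      have := congrArg (Polynomial.eval t) hq
      rw [Polynomial.eval_mul, ht, mul_zero] at this
      exact h t (by simpa [hp] using this))
  have hrdeg : r.natDegree = 0 := by
    have h1 := (hmon σ).natDegree_mul' (q := r) (by
      rintro rfl
      simp [hr] at hqdeg)
    rw [← hr, hqdeg, hmdeg] at h1
    omega
  obtain ⟨k, rfl⟩ := Polynomial.natDegree_eq_zero.mp hrdeg
  rw [hr] at hq
  have key : ∀ t : ℝ, c₄ * t ^ 4 + c₃ * t ^ 3 + c₂ * t ^ 2 + c₁ * t + c₀ =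
      (t ^ 2 - 2 * τ.re * t + Complex.normSq τ) *
        ((t ^ 2 - 2 * σ.re * t + Complex.normSq σ) * k) := by
    intro t
    simpa [hp] using congrArg (Polynomial.eval t) hq
  have k0 := key 0
  have k1 := key 1
  have k2 := key (-1)
  have k3 := key 2
  have k4 := key (-2)
  have hk : c₄ = k := by linear_combination (k3 + k4 - 4 * k1 - 4 * k2 + 6 * k0) / 24
  subst hk
  refine ⟨τ, σ, hτ, hσ, ?_, ?_, ?_, ?_⟩
  · linear_combination (k3 - k4 - 2 * k1 + 2 * k2) / 12
  · linear_combination (-k3 - k4 + 16 * k1 + 16 * k2 - 30 * k0) / 24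
  · linear_combination (-k3 + k4 + 8 * k1 - 8 * k2) / 12
  · linear_combination k0

lemma quadForm_expand_multilinear {C : Fin 3 → Fin 3 → Fin 3 → Fin 3 → ℝ} (hC : IsSymmArray C)
    (u v : Fin 3 → ℝ) (x₁ y₁ x₂ y₂ x₃ y₃ x₄ y₄ : ℝ) :
    quadForm C (x₁ • u + y₁ • v) (x₂ • u + y₂ • v) (x₃ • u + y₃ • v) (x₄ • u + y₄ • v) =
      x₁ * x₂ * x₃ * x₄ * quadForm C u u u u
      + (y₁ * x₂ * x₃ * x₄ + x₁ * y₂ * x₃ * x₄ + x₁ * x₂ * y₃ * x₄ + x₁ * x₂ * x₃ * y₄)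
        * quadForm C u u u v
      + (x₁ * x₂ * y₃ * y₄ + x₁ * y₂ * x₃ * y₄ + x₁ * y₂ * y₃ * x₄ + y₁ * x₂ * x₃ * y₄
        + y₁ * x₂ * y₃ * x₄ + y₁ * y₂ * x₃ * x₄) * quadForm C u u v v
      + (x₁ * y₂ * y₃ * y₄ + y₁ * x₂ * y₃ * y₄ + y₁ * y₂ * x₃ * y₄ + y₁ * y₂ * y₃ * x₄)
        * quadForm C u v v v
      + y₁ * y₂ * y₃ * y₄ * quadForm C v v v v := by
  have s1 := fun p q r s => quadForm_swap₁ hC p q r s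
  have s2 := fun p q r s => quadForm_swap₂ hC p q r s
  have s3 := fun p q r s => quadForm_swap₃ hC p q r s
  have uuvu : quadForm C u u v u = quadForm C u u u v := s3 _ _ _ _
  have uvuu : quadForm C u v u u = quadForm C u u u v := (s2 _ _ _ _).trans uuvu
  have vuuu : quadForm C v u u u = quadForm C u u u v := (s1 _ _ _ _).trans uvuu
  have uvuv : quadForm C u v u v = quadForm C u u v v := s2 _ _ _ _
  have uvvu : quadForm C u v v u = quadForm C u u v v := (s3 _ _ _ _).trans uvuv
  have vuuv : quadForm C v u u v = quadForm C u u v v := (s1 _ _ _ _).trans uvuv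
  have vuvu : quadForm C v u v u = quadForm C u u v v := (s1 _ _ _ _).trans uvvu
  have vvuu : quadForm C v v u u = quadForm C u u v v := (s2 _ _ _ _).trans vuvu
  have vuvv : quadForm C v u v v = quadForm C u v v v := s1 _ _ _ _
  have vvuv : quadForm C v v u v = quadForm C u v v v := (s2 _ _ _ _).trans vuvv
  have vvvu : quadForm C v v v u = quadForm C u v v v := (s3 _ _ _ _).trans vvuv
  simp only [quadForm_add_smul, quadForm_add_smul₂ hC, quadForm_add_smul₃ hC,
    quadForm_add_smul₄ hC, uuvu, uvuu, vuuu, uvuv, uvvu, vuuv, vuvu, vvuu, vuvv, vvuv, vvvu]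
  ring

lemma hasWinding_planeDefect_frame {C : Fin 3 → Fin 3 → Fin 3 → Fin 3 → ℝ} (hC : IsSymmArray C)
    {u v : Fin 3 → ℝ}
    (hne : ∀ x y : ℝ, x ≠ 0 ∨ y ≠ 0 → quadForm C (x • u + y • v) (x • u + y • v) (x • u + y • v)
      (x • u + y • v) ≠ 0)
    (hsq : ∀ K μ ν : ℝ, ¬ IsSquareOn C u v K μ ν) :
    HasWinding (fun θ => planeDefect C (frameDir u v θ) (frameDir' u v θ)) (-4) := by
  have hK : quadForm C u u u u ≠ 0 := by simpa using hne 1 0 (by simp)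
  obtain ⟨τ, σ, hτ, hσ, h3, h2, h1, h0⟩ := exists_definite_factorization hK
    (c₃ := 4 * quadForm C u u u v) (c₂ := 6 * quadForm C u u v v)
    (c₁ := 4 * quadForm C u v v v) (c₀ := quadForm C v v v v) (fun t => by
      have := hne t 1 (by simp)
      rw [quadForm_expand hC] at this
      simpa using this)
  have hτσ : τ - σ ≠ 0 := by
    intro h
    rw [sub_eq_zero] at h
    subst h
    exact hsq (quadForm C u u u u) (-2 * τ.re) (Complex.normSq τ)
      ⟨rfl, by rw [h3]; ring, by rw [h2]; ring, by rw [h1]; ring, by rw [h0]; ring⟩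
  set K := quadForm C u u u u with hKdef
  obtain ⟨a, y⟩ := τ
  obtain ⟨b, z⟩ := σ
  simp only [Complex.normSq_mk] at hτ hσ h3 h2 h1 h0
  have e1 : quadForm C u u u v = K * (-2 * a - 2 * b) / 4 := by rw [← h3]; ring
  have e2 : quadForm C u u v v = K * (a * a + y * y + 4 * a * b + (b * b + z * z)) / 6 := by
    rw [← h2]; ring
  have e3 : quadForm C u v v v =
    K * (-2 * a * (b * b + z * z) - 2 * b * (a * a + y * y)) / 4 := by rw [← h1]; ring
  set α₂ : ℝ → ℝ := fun θ => (cos θ - a * sin θ) ^ 2 + (y * sin θ) ^ 2 with hα₂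
  set α₁ : ℝ → ℝ := fun θ => -2 * ((cos θ - a * sin θ) * (sin θ + a * cos θ)
    - y ^ 2 * (sin θ * cos θ)) with hα₁
  set α₀ : ℝ → ℝ := fun θ => (sin θ + a * cos θ) ^ 2 + (y * cos θ) ^ 2 with hα₀
  set β₂ : ℝ → ℝ := fun θ => (cos θ - b * sin θ) ^ 2 + (z * sin θ) ^ 2 with hβ₂
  set β₁ : ℝ → ℝ := fun θ => -2 * ((cos θ - b * sin θ) * (sin θ + b * cos θ)
    - z ^ 2 * (sin θ * cos θ)) with hβ₁
  set β₀ : ℝ → ℝ := fun θ => (sin θ + b * cos θ) ^ 2 + (z * cos θ) ^ 2 with hβ₀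
  have hpos : ∀ a y : ℝ, 0 < y → ∀ θ, 0 < (cos θ - a * sin θ) ^ 2 + (y * sin θ) ^ 2 := by
    intro a y hy θ
    rcases eq_or_ne (sin θ) 0 with hs | hs
    · have := sin_sq_add_cos_sq θ
      have hc : cos θ ≠ 0 := by
        intro hc
        simp [hs, hc] at this
      simp only [hs, mul_zero, sub_zero]
      positivity
    · positivity
  have hα₂pos : ∀ θ, 0 < α₂ θ := hpos a y hτ
  have hβ₂pos : ∀ θ, 0 < β₂ θ := hpos b z hσ
  have hform : ∀ θ, planeDefect C (frameDir u v θ) (frameDir' u v θ) =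
      sqDefect (K * (α₂ θ * β₂ θ)) (K * (α₂ θ * β₁ θ + α₁ θ * β₂ θ))
        (K * (α₂ θ * β₀ θ + α₁ θ * β₁ θ + α₀ θ * β₂ θ))
        (K * (α₁ θ * β₀ θ + α₀ θ * β₁ θ)) (K * (α₀ θ * β₀ θ)) := by
    intro θ
    unfold planeDefect frameDir frameDir'
    simp only [quadForm_expand_multilinear hC, ← hKdef, e1, e2, e3, h0, hα₂, hα₁, hα₀,
      hβ₂, hβ₁, hβ₀]
    congr 1 <;> ring
  have hdisc : ∀ a y θ : ℝ, 4 * ((cos θ - a * sin θ) ^ 2 + (y * sin θ) ^ 2) *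
      ((sin θ + a * cos θ) ^ 2 + (y * cos θ) ^ 2) =
      (-2 * ((cos θ - a * sin θ) * (sin θ + a * cos θ) - y ^ 2 * (sin θ * cos θ))) ^ 2
        + 4 * y ^ 2 := by
    intro a y θ
    have := sin_sq_add_cos_sq θ
    linear_combination 4 * y ^ 2 * (sin θ ^ 2 + cos θ ^ 2 + 1) * this
  have hval := fun θ => (hform θ).trans (sqDefect_mul_eq (hdisc a y θ) (hdisc b z θ)
    (hα₂pos θ).ne' (hβ₂pos θ).ne' rfl rfl rfl)
  have hw := (HasWinding.const hτσ).mul ((hasWinding_cos_sub_mul_sin (τ := ⟨a, y⟩) hτ).mul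
    (hasWinding_cos_sub_mul_sin (τ := ⟨b, z⟩) hσ)).conj
  refine HasWinding.of_parts (k := 2) (P := fun θ => y * β₂ θ - z * α₂ θ)
    (S := fun θ => y * β₂ θ + z * α₂ θ) (R := fun θ => β₁ θ * α₂ θ - α₁ θ * β₂ θ)
    (M := fun θ => α₂ θ * β₂ θ) (c := 4 * K ^ 4) ?_ (by fun_prop)
    (fun θ => by simp only [hα₂, hβ₂, sin_add_two_pi, cos_add_two_pi])
    (fun θ => by have := hα₂pos θ; have := hβ₂pos θ; positivity)
    (fun θ => mul_pos (hα₂pos θ) (hβ₂pos θ)) (by positivity) ?_ ?_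
    (fun θ => by rw [hval θ]) (fun θ => by rw [hval θ])
  · rw [show (0 : ℤ) + -(-1 + -1) = 2 by norm_num] at hw
    convert hw using 2 with θ
    have := sin_sq_add_cos_sq θ
    refine Complex.ext ?_ ?_ <;>
      simp only [hα₂, hα₁, hβ₂, hβ₁, Complex.add_re, Complex.add_im, Complex.sub_re,
        Complex.sub_im, Complex.mul_re, Complex.mul_im, Complex.conj_re, Complex.conj_im,
        Complex.ofReal_re, Complex.ofReal_im, Complex.I_re, Complex.I_im]
    · linear_combination ((a - b) * ((cos θ - a * sin θ) * (cos θ - b * sin θ)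
        - y * z * sin θ ^ 2) - (y - z) * (z * sin θ * (cos θ - a * sin θ)
        + y * sin θ * (cos θ - b * sin θ))) * this
    · ring
  · simp only [hform, sqDefect_eq]
    fun_prop
  · intro θ
    simp only [hform, hα₂, hα₁, hα₀, hβ₂, hβ₁, hβ₀, sin_add_two_pi, cos_add_two_pi]

end boundary

section counting

open Matrix Real

variable {f : MvPolynomial (Fin 3) ℝ} {u v w : Fin 3 → ℝ}

lemma planeDefect_neg {C : Fin 3 → Fin 3 → Fin 3 → Fin 3 → ℝ} (hC : IsSymmArray C)
    (a b : Fin 3 → ℝ) : planeDefect C a (-b) = (starRingEnd ℂ) (planeDefect C a b) := by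
  have h := quadForm_expand_multilinear hC a b
  have h₃ := h 1 0 1 0 1 0 0 (-1)
  have h₂ := h 1 0 1 0 0 (-1) 0 (-1)
  have h₁ := h 1 0 0 (-1) 0 (-1) 0 (-1)
  have h₀ := h 0 (-1) 0 (-1) 0 (-1) 0 (-1)
  simp only [one_smul, zero_smul, add_zero, zero_add, neg_one_smul] at h₃ h₂ h₁ h₀
  rw [planeDefect, h₃, h₂, h₁, h₀]
  apply Complex.ext <;> simp [planeDefect, sqDefect] <;> ring

lemma stripDefect_add_int_mul (C : Fin 3 → Fin 3 → Fin 3 → Fin 3 → ℝ) (ζ : ℂ) (n : ℤ) :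
    stripDefect C u v w (ζ + n * (2 * π * Complex.I)) = stripDefect C u v w ζ := by
  have hre : (ζ + n * (2 * π * Complex.I)).re = ζ.re := by simp
  have him : (ζ + n * (2 * π * Complex.I)).im = ζ.im + n * (2 * π) := by simp
  simp only [stripDefect, framePt, frameDir, frameDir', hre, him, cos_add_int_mul_two_pi,
    sin_add_int_mul_two_pi]

lemma stripDefect_pi_div_two (C : Fin 3 → Fin 3 → Fin 3 → Fin 3 → ℝ) (θ : ℝ) :
    stripDefect C u v w ((π / 2 : ℝ) + θ * Complex.I) =
      planeDefect C (frameDir u v θ) (frameDir' u v θ) := by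
  simp [stripDefect, framePt]

lemma stripDefect_neg_pi_div_two (C : Fin 3 → Fin 3 → Fin 3 → Fin 3 → ℝ) (θ : ℝ) :
    stripDefect C u v w (-(π / 2 : ℝ) + θ * Complex.I) =
      planeDefect C (frameDir u v θ) (-frameDir' u v θ) := by
  simp [stripDefect, framePt]

lemma cross_frame_ne_zero (huvw : lin (u ⨯₃ v) w ≠ 0) (φ θ : ℝ) :
    frameDir u v θ ⨯₃ framePt u v w φ θ ≠ 0 := by
  intro h
  have := lin_cross_frame (u := u) (v := v) (w := w) φ θ
  rw [h] at this
  exact huvw (by simpa [lin] using this)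

/-- The line spanned by the moving frame. -/
def frameLine (huvw : lin (u ⨯₃ v) w ≠ 0) (ζ : ℂ) : Projectivization ℝ (Fin 3 → ℝ) :=
  Projectivization.mk ℝ _ (cross_frame_ne_zero huvw ζ.re ζ.im)

lemma frameLine_injective (huvw : lin (u ⨯₃ v) w ≠ 0) {ζ ξ : ℂ} (hζ : |ζ.re| < π / 2)
    (hξ : |ξ.re| < π / 2) (him : |ζ.im - ξ.im| < π)
    (h : frameLine huvw ζ = frameLine huvw ξ) : ζ = ξ := by
  obtain ⟨t, ht⟩ := (Projectivization.mk_eq_mk_iff' _ _ _ _ _).mp h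
  rw [abs_lt] at hζ hξ him
  have hcζ : 0 < cos ζ.re := cos_pos_of_mem_Ioo ⟨by linarith, by linarith⟩
  have hcξ : 0 < cos ξ.re := cos_pos_of_mem_Ioo ⟨by linarith, by linarith⟩
  have coord_v : ∀ φ θ, lin (frameDir u v θ ⨯₃ framePt u v w φ θ) v =
      -(cos φ * cos θ) * lin (u ⨯₃ v) w := by
    intro φ θ
    rw [cross_frame]
    simp [lin, Fin.sum_univ_three, cross_apply]; ring
  have coord_u : ∀ φ θ, lin (frameDir u v θ ⨯₃ framePt u v w φ θ) u =
      (cos φ * sin θ) * lin (u ⨯₃ v) w := by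
    intro φ θ
    rw [cross_frame]
    simp [lin, Fin.sum_univ_three, cross_apply]; ring
  have coord_w : ∀ φ θ, lin (frameDir u v θ ⨯₃ framePt u v w φ θ) w =
      sin φ * lin (u ⨯₃ v) w := by
    intro φ θ
    rw [cross_frame]
    simp [lin, Fin.sum_univ_three, cross_apply]; ring
  have ev := congrArg (fun x => lin x v) ht
  have eu := congrArg (fun x => lin x u) ht
  have ew := congrArg (fun x => lin x w) ht
  simp only [lin_smul_left, coord_v, coord_u, coord_w] at ev eu ew
  have ec : t * (cos ξ.re * cos ξ.im) = cos ζ.re * cos ζ.im :=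
    mul_right_cancel₀ huvw (by linear_combination -ev)
  have es : t * (cos ξ.re * sin ξ.im) = cos ζ.re * sin ζ.im :=
    mul_right_cancel₀ huvw (by linear_combination eu)
  have ep : t * sin ξ.re = sin ζ.re := mul_right_cancel₀ huvw (by linear_combination ew)
  have hθ : ζ.im - ξ.im = 0 := by
    refine (sin_eq_zero_iff_of_lt_of_lt him.1 him.2).mp ?_
    refine (mul_eq_zero.mp (?_ : (cos ζ.re * cos ξ.re) * sin (ζ.im - ξ.im) = 0)).resolve_left
      (mul_pos hcζ hcξ).ne'
    rw [sin_sub]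
    linear_combination cos ξ.re * sin ξ.im * ec - cos ξ.re * cos ξ.im * es
  have hθ' : ζ.im = ξ.im := sub_eq_zero.mp hθ
  have et : t * cos ξ.re = cos ζ.re := by
    rw [hθ'] at ec es
    have h1 := sin_sq_add_cos_sq ξ.im
    linear_combination cos ξ.im * ec + sin ξ.im * es - (t * cos ξ.re - cos ζ.re) * h1
  have hφ : ζ.re - ξ.re = 0 := by
    refine (sin_eq_zero_iff_of_lt_of_lt (by linarith) (by linarith)).mp ?_
    rw [sin_sub]
    linear_combination sin ξ.re * et - cos ξ.re * ep
  exact Complex.ext (sub_eq_zero.mp hφ) hθ'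

/-- A real line without real points of the quartic which is not a bitangent forces at least four
real bitangents: each of them accounts for two zeros of `stripDefect`, and the winding numbers of
`stripDefect` along the two boundary lines of the strip are `-4` and `4`. -/
lemma four_le_ncard_realBitangents (hf : f.IsHomogeneous 4) (hsm : SmoothQuartic f)
    (huvw : lin (u ⨯₃ v) w ≠ 0)
    (hne : ∀ x y : ℝ, x ≠ 0 ∨ y ≠ 0 → eval (x • u + y • v) f ≠ 0)
    (hsq : ∀ K μ ν : ℝ, ¬ IsSquareOn (polarArray f) u v K μ ν)
    (hfin : (realBitangents f).Finite) : 4 ≤ (realBitangents f).ncard := by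
  set C := polarArray f with hCdef
  have hC : IsSymmArray C := isSymmArray_polarArray f
  set F := stripDefect C u v w with hF
  have hdir : ∀ θ, quadForm C (frameDir u v θ) (frameDir u v θ) (frameDir u v θ)
      (frameDir u v θ) ≠ 0 := by
    intro θ
    rw [quadForm_polarArray hf]
    refine hne _ _ ?_
    by_contra! h
    have := sin_sq_add_cos_sq θ
    rw [h.1, h.2] at this
    norm_num at this
  have hW : HasWinding (fun θ => planeDefect C (frameDir u v θ) (frameDir' u v θ)) (-4) :=
    hasWinding_planeDefect_frame hC (fun x y hxy => by
      rw [quadForm_polarArray hf]; exact hne x y hxy) hsq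
  have hW₁ : HasWinding (fun θ : ℝ => F ((π / 2 : ℝ) + θ * Complex.I)) (-4) := by
    simpa only [hF, stripDefect_pi_div_two] using hW
  have hW₂ : HasWinding (fun θ : ℝ => F (-(π / 2 : ℝ) + θ * Complex.I)) 4 := by
    simpa only [hF, stripDefect_neg_pi_div_two, planeDefect_neg hC, neg_neg] using hW.conj
  have hline : ∀ ζ, F ζ = 0 → frameLine huvw ζ ∈ realBitangents f := by
    intro ζ h0
    obtain ⟨μ, ν, H⟩ := exists_isSquareOn (hdir ζ.im) h0
    exact mk_cross_mem_realBitangents hf _ (hdir ζ.im) H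
  let S (c : ℝ) : Set ℂ := {ζ | |ζ.re| < π / 2 ∧ ζ.im ∈ Set.Ico c (c + π) ∧ F ζ = 0}
  have hinj : ∀ c, Set.InjOn (frameLine huvw) (S c) := by
    intro c ζ hζ ξ hξ h
    obtain ⟨⟨h1, h2⟩, h3, h4⟩ := And.intro hζ.2.1 hξ.2.1
    exact frameLine_injective huvw hζ.1 hξ.1 (abs_lt.mpr ⟨by linarith, by linarith⟩) h
  have hSfin : ∀ c, (S c).Finite := fun c =>
    Set.Finite.of_injOn (fun ζ hζ => hline ζ hζ.2.2) (hinj c) hfin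
  have hScard : ∀ c, (S c).ncard ≤ (realBitangents f).ncard := fun c =>
    Set.ncard_le_ncard_of_injOn _ (fun ζ hζ => hline ζ hζ.2.2) (hinj c) hfin
  have hZfin := (hSfin 0).union (hSfin π)
  set Z := hZfin.toFinset with hZ
  have hmem : ∀ ζ, ζ ∈ Z ↔ |ζ.re| < π / 2 ∧ ζ.im ∈ Set.Ico 0 (2 * π) ∧ F ζ = 0 := by
    intro ζ
    simp only [hZ, Set.Finite.mem_toFinset, Set.mem_union, S, Set.mem_ofPred_eq, Set.mem_Ico]
    constructor
    · rintro (⟨h1, h2, h3⟩ | ⟨h1, h2, h3⟩)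
      · exact ⟨h1, ⟨h2.1, by linarith [pi_pos]⟩, h3⟩
      · exact ⟨h1, ⟨by linarith [pi_pos], by linarith⟩, h3⟩
    · rintro ⟨h1, h2, h3⟩
      rcases lt_or_ge ζ.im π with h | h
      · exact Or.inl ⟨h1, ⟨h2.1, by linarith⟩, h3⟩
      · exact Or.inr ⟨h1, ⟨h, by linarith⟩, h3⟩
  have hZcard : Z.card ≤ 2 * (realBitangents f).ncard := by
    rw [hZ, ← Set.ncard_eq_toFinset_card _ hZfin]
    have := Set.ncard_union_le (S 0) (S π)
    have h1 := hScard 0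
    have h2 := hScard π
    omega
  have hcount := winding_sub_le_card_zeros (a := π / 2) (by positivity) Z F (-4) 4
    (differentiable_stripDefect C).continuous
    (fun ζ => by simpa using stripDefect_add_int_mul (u := u) (v := v) (w := w) C ζ 1)
    (fun z hz => ((hmem z).mp hz).1) ?_ ?_ ?_ hW₁ hW₂
  · norm_num at hcount
    omega
  · intro z hz z' hz' h
    obtain ⟨n, hn⟩ := Complex.exp_eq_exp_iff_exists_int.mp h
    have h1 := ((hmem z).mp hz).2.1
    have h2 := ((hmem z').mp hz').2.1
    have him : z.im = z'.im + n * (2 * π) := by simp [hn]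
    have hn0 : n = 0 := by
      have hlt : (n : ℝ) < 1 := by
        by_contra! hge
        nlinarith [h1.2, h2.1, pi_pos]
      have hgt : (-1 : ℝ) < n := by
        by_contra! hge
        nlinarith [h1.1, h2.2, pi_pos]
      have hlt' : n < 1 := by exact_mod_cast hlt
      have hgt' : -1 < n := by exact_mod_cast hgt
      omega
    simpa [hn0] using hn
  · intro ζ hζ h0
    have hlt : |ζ.re| < π / 2 := by
      refine lt_of_le_of_ne hζ fun heq => ?_
      rcases (abs_eq (by positivity)).mp heq with h | h
      · refine hW₁.ne_zero ζ.im ?_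
        rw [← h, Complex.re_add_im]; exact h0
      · refine hW₂.ne_zero ζ.im ?_
        rw [← Complex.ofReal_neg, ← h, Complex.re_add_im]; exact h0
    set n := toIcoDiv two_pi_pos 0 ζ.im
    refine ⟨ζ + (-n : ℤ) * (2 * π * Complex.I), (hmem _).mpr ⟨by simpa using hlt, ?_, ?_⟩, ?_⟩
    · have := toIcoMod_mem_Ico two_pi_pos 0 ζ.im
      rw [toIcoMod] at this
      simpa [sub_eq_add_neg] using this
    · rw [hF, stripDefect_add_int_mul]; exact h0
    · exact Complex.exp_eq_exp_iff_exists_int.mpr ⟨n, by push_cast; ring⟩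
  · intro z hz
    obtain ⟨h1, -, h0⟩ := (hmem z).mp hz
    exact ⟨h0, exists_injective_hasFDerivAt_stripDefect hf hsm huvw h1 (hdir z.im) h0⟩

lemma exists_cross_eq_smul {ℓ : Fin 3 → ℝ} (hℓ : ℓ ≠ 0) :
    ∃ (u v : Fin 3 → ℝ) (c : ℝ), c ≠ 0 ∧ u ⨯₃ v = c • ℓ := by
  obtain ⟨i, hi⟩ := Function.ne_iff.mp hℓ
  fin_cases i
  · refine ⟨![-ℓ 1, ℓ 0, 0], ![-ℓ 2, 0, ℓ 0], ℓ 0, hi, ?_⟩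
    funext j; fin_cases j <;> simp [cross_apply]; ring
  · refine ⟨![0, -ℓ 2, ℓ 1], ![ℓ 1, -ℓ 0, 0], ℓ 1, hi, ?_⟩
    funext j; fin_cases j <;> simp [cross_apply]; ring
  · refine ⟨![ℓ 2, 0, -ℓ 0], ![0, ℓ 2, -ℓ 1], ℓ 2, hi, ?_⟩
    funext j; fin_cases j <;> simp [cross_apply]; ring

lemma four_le_ncard_of_line (hf : f.IsHomogeneous 4) (hsm : SmoothQuartic f) {ℓ : Fin 3 → ℝ}
    (hℓ : ℓ ≠ 0) (hno : ∀ p : Fin 3 → ℝ, p ≠ 0 → lin ℓ p = 0 → eval p f ≠ 0)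
    (hmk : Projectivization.mk ℝ ℓ hℓ ∉ realBitangents f) (hfin : (realBitangents f).Finite) :
    4 ≤ (realBitangents f).ncard := by
  obtain ⟨u, v, c, hc, huv⟩ := exists_cross_eq_smul hℓ
  have hcross : u ⨯₃ v ≠ 0 := huv ▸ smul_ne_zero hc hℓ
  have hne : ∀ x y : ℝ, x ≠ 0 ∨ y ≠ 0 → eval (x • u + y • v) f ≠ 0 := by
    intro x y hxy
    refine hno _ (fun h => ?_) ?_
    · have hx : x • (u ⨯₃ v) = (x • u + y • v) ⨯₃ v := by simp
      have hy : y • (u ⨯₃ v) = u ⨯₃ (x • u + y • v) := by simp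
      rw [h] at hx hy
      simp only [LinearMap.zero_apply, map_zero, smul_eq_zero, hcross, or_false] at hx hy
      exact hxy.elim (fun k => k hx) fun k => k hy
    · have : lin (u ⨯₃ v) (x • u + y • v) = 0 := by
        simp [lin, Fin.sum_univ_three, cross_apply]; ring
      rw [huv, lin_smul_left] at this
      exact (mul_eq_zero.mp this).resolve_left hc
  refine four_le_ncard_realBitangents hf hsm (lin_self_ne_zero hcross) hne (fun K μ ν H => hmk ?_)
    hfin
  have hK : K ≠ 0 := by
    rw [← H.coeff₄, quadForm_polarArray hf]
    simpa using hne 1 0 (by simp)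
  have := mk_cross_mem_realBitangents hf hcross hK H
  rwa [(Projectivization.mk_eq_mk_iff' ℝ (u ⨯₃ v) ℓ hcross hℓ).mpr ⟨c, huv.symm⟩] at this

lemma eventually_forall_eval_ne_zero (hf : f.IsHomogeneous 4) {ℓ : Fin 3 → ℝ} (η : Fin 3 → ℝ)
    (hno : ∀ p : Fin 3 → ℝ, p ≠ 0 → lin ℓ p = 0 → eval p f ≠ 0) :
    ∀ᶠ ε : ℝ in nhds 0, ∀ p : Fin 3 → ℝ, p ≠ 0 → lin (ℓ + ε • η) p = 0 → eval p f ≠ 0 := by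
  have key : ∀ᶠ ε : ℝ in nhds 0, ∀ p ∈ Metric.sphere (0 : Fin 3 → ℝ) 1,
      lin (ℓ + ε • η) p ≠ 0 ∨ eval p f ≠ 0 := by
    refine (isCompact_sphere _ _).eventually_forall_of_forall_eventually fun p hp => ?_
    have hp0 : p ≠ 0 := by
      rintro rfl
      simp at hp
    have hlin : Continuous fun z : ℝ × (Fin 3 → ℝ) => lin (ℓ + z.1 • η) z.2 := by
      simp only [lin, Pi.add_apply, Pi.smul_apply, smul_eq_mul]
      fun_prop
    have heval : Continuous fun z : ℝ × (Fin 3 → ℝ) => eval z.2 f :=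
      (MvPolynomial.continuous_eval f).comp continuous_snd
    by_cases h : lin ℓ p = 0
    · filter_upwards [heval.continuousAt.eventually_ne (hno p hp0 h)] with z hz using Or.inr hz
    · have h' : lin (ℓ + (0 : ℝ) • η) p ≠ 0 := by simpa using h
      filter_upwards [(hlin.continuousAt (x := (0, p))).eventually_ne h'] with z hz using Or.inl hz
  filter_upwards [key] with ε hε p hp hlin heval
  have hn : ‖p‖ ≠ 0 := norm_ne_zero_iff.mpr hp
  have hs : ‖p‖⁻¹ • p ∈ Metric.sphere (0 : Fin 3 → ℝ) 1 := by
    simp [norm_smul, hn]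
  rcases hε _ hs with h | h
  · refine h ?_
    have : lin (ℓ + ε • η) (‖p‖⁻¹ • p) = ‖p‖⁻¹ * lin (ℓ + ε • η) p := by
      simp [lin, Fin.sum_univ_three]; ring
    rw [this, hlin, mul_zero]
  · refine h ?_
    have := quadForm_expand (isSymmArray_polarArray f) ‖p‖⁻¹ 0 p 0
    rw [zero_smul, add_zero, quadForm_polarArray hf, quadForm_polarArray hf, heval] at this
    rw [this]; ring

/-- A line without real points can be moved off a finite set of lines. -/
lemma exists_line_notMem (hf : f.IsHomogeneous 4) {ℓ : Fin 3 → ℝ} (hℓ : ℓ ≠ 0)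
    (hno : ∀ p : Fin 3 → ℝ, p ≠ 0 → lin ℓ p = 0 → eval p f ≠ 0)
    {T : Set (Projectivization ℝ (Fin 3 → ℝ))} (hT : T.Finite) :
    ∃ (m : Fin 3 → ℝ) (hm : m ≠ 0), (∀ p, p ≠ 0 → lin m p = 0 → eval p f ≠ 0) ∧
      Projectivization.mk ℝ m hm ∉ T := by
  obtain ⟨η, v, c, hc, hv⟩ := exists_cross_eq_smul hℓ
  have hη : η ≠ 0 := by
    rintro rfl
    refine smul_ne_zero hc hℓ ?_
    rw [← hv]; simp
  have hℓη : lin ℓ η = 0 := by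
    have : lin (η ⨯₃ v) η = 0 := by
      simp [lin, Fin.sum_univ_three, cross_apply]; ring
    rw [hv, lin_smul_left] at this
    exact (mul_eq_zero.mp this).resolve_left hc
  have coord_ℓ : ∀ ε : ℝ, lin (ℓ + ε • η) ℓ = lin ℓ ℓ := by
    intro ε
    have : lin (ℓ + ε • η) ℓ = lin ℓ ℓ + ε * lin ℓ η := by
      simp [lin, Fin.sum_univ_three]; ring
    rw [this, hℓη, mul_zero, add_zero]
  have coord_η : ∀ ε : ℝ, lin (ℓ + ε • η) η = ε * lin η η := by
    intro ε
    have : lin (ℓ + ε • η) η = lin ℓ η + ε * lin η η := by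
      simp [lin, Fin.sum_univ_three]; ring
    rw [this, hℓη, zero_add]
  have hm : ∀ ε : ℝ, ℓ + ε • η ≠ 0 := by
    intro ε h
    have := coord_ℓ ε
    rw [h] at this
    exact lin_self_ne_zero hℓ (by simpa [lin] using this.symm)
  have hinj : Function.Injective fun ε : ℝ => Projectivization.mk ℝ (ℓ + ε • η) (hm ε) := by
    intro ε δ h
    obtain ⟨t, ht⟩ := (Projectivization.mk_eq_mk_iff' _ _ _ _ _).mp h
    have e1 := congrArg (fun x => lin x ℓ) ht
    have e2 := congrArg (fun x => lin x η) ht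
    simp only [lin_smul_left, coord_ℓ, coord_η] at e1 e2
    have h1 : t = 1 := mul_right_cancel₀ (lin_self_ne_zero hℓ) (by rw [e1, one_mul])
    exact mul_right_cancel₀ (lin_self_ne_zero hη) (by rw [← e2, h1, one_mul])
  by_contra! H
  refine infinite_of_mem_nhds (0 : ℝ) (eventually_forall_eval_ne_zero hf η hno) ?_
  exact Set.Finite.of_injOn (fun ε hε => H _ (hm ε) hε) hinj.injOn hT

end counting

lemma Set.exists_four_of_four_le_ncard {α : Type*} {s : Set α}
    (h : s.Finite → 4 ≤ s.ncard) : ∃ a b c d, a ∈ s ∧ b ∈ s ∧ c ∈ s ∧ d ∈ s ∧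
      a ≠ b ∧ a ≠ c ∧ a ≠ d ∧ b ≠ c ∧ b ≠ d ∧ c ≠ d := by
  obtain ⟨g⟩ : Nonempty (Fin 4 ↪ s) := by
    rcases s.finite_or_infinite with hs | hs
    · have := hs.fintype
      refine Function.Embedding.nonempty_of_card_le ?_
      rw [Fintype.card_fin, ← Nat.card_eq_fintype_card, Nat.card_coe_set_eq]
      exact h hs
    · have := hs.to_subtype
      exact ⟨Fin.valEmbedding.trans (_root_.Infinite.natEmbedding s)⟩
  have hg : ∀ i j, i ≠ j → (g i : α) ≠ g j := fun i j hij h =>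
    hij (g.injective (Subtype.ext h))
  exact ⟨g 0, g 1, g 2, g 3, (g 0).2, (g 1).2, (g 2).2, (g 3).2, hg _ _ (by decide),
    hg _ _ (by decide), hg _ _ (by decide), hg _ _ (by decide), hg _ _ (by decide),
    hg _ _ (by decide)⟩

/-- If the smooth real plane quartic `V(f)` has a real line `L∞`
containing no real point of the curve, then `V(f)` has at least 4 distinct real
bitangent lines. -/
theorem statement1 (f : MvPolynomial (Fin 3) ℝ) (hf : f.IsHomogeneous 4)
    (hsm : SmoothQuartic f)
    (ℓinf : Fin 3 → ℝ) (hinf : ℓinf ≠ 0)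
    (hno : ∀ p : Fin 3 → ℝ, p ≠ 0 → lin ℓinf p = 0 → eval p f ≠ 0) :
    ∃ L₁ L₂ L₃ L₄ : Projectivization ℝ (Fin 3 → ℝ),
      L₁ ∈ realBitangents f ∧ L₂ ∈ realBitangents f ∧
      L₃ ∈ realBitangents f ∧ L₄ ∈ realBitangents f ∧
      L₁ ≠ L₂ ∧ L₁ ≠ L₃ ∧ L₁ ≠ L₄ ∧ L₂ ≠ L₃ ∧ L₂ ≠ L₄ ∧ L₃ ≠ L₄ := by
  refine Set.exists_four_of_four_le_ncard fun hfin => ?_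
  obtain ⟨m, hm, hno', hmk⟩ := exists_line_notMem hf hinf hno hfin
  exact four_le_ncard_of_line hf hsm hm hno' hmk hfin

end
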